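/- arXiv:2012.12129 — 2 statements merged into one kernel-verified Lean document; each statement's English description precedes it below -/
import Mathlib

section
/- For every integer n ≥ 3, the quantity c_n := (1/(2n)) * ((1/3) * tan(π/n) + cot(π/n)) equals the minimal second moment ∫_P |x - ξ|² dx over all convex n-gons P of unit area and all points ξ ∈ ℝ², and this infimum is attained by a regular n-gon about its center. -/
open Real MeasureTheory Set

noncomputable def cFun (n : ℝ) : ℝ :=
  1 / (2 * n) * ((1 / 3) * Real.tan (π / n) + Real.cot (π / n))

noncomputable def secondMoment (P : Set (EuclideanSpace ℝ (Fin 2)))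
    (ξ : EuclideanSpace ℝ (Fin 2)) : ℝ :=
  ∫ x in P, ‖x - ξ‖ ^ 2

/-- `P` is a convex polygon with `n` vertices (the convex hull of `n` points). -/
def IsConvexNGon (n : ℕ) (P : Set (EuclideanSpace ℝ (Fin 2))) : Prop :=
  ∃ V : Finset (EuclideanSpace ℝ (Fin 2)), V.card = n ∧
    P = convexHull ℝ (V : Set (EuclideanSpace ℝ (Fin 2)))

noncomputable def regularVertex (n : ℕ) (c : EuclideanSpace ℝ (Fin 2)) (r θ : ℝ)
    (k : ℕ) : EuclideanSpace ℝ (Fin 2) :=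
  c + r • (WithLp.equiv 2 (Fin 2 → ℝ)).symm
    ![Real.cos (2 * π * k / n + θ), Real.sin (2 * π * k / n + θ)]

/-- `P` is a regular `n`-gon with centre `c`. -/
def IsRegularNGon (n : ℕ) (P : Set (EuclideanSpace ℝ (Fin 2)))
    (c : EuclideanSpace ℝ (Fin 2)) : Prop :=
  ∃ r θ : ℝ, 0 < r ∧
    P = convexHull ℝ (Set.range fun k : Fin n => regularVertex n c r θ k)


namespace MomentLemma

abbrev E2 := EuclideanSpace ℝ (Fin 2)

/-- The planar determinant. -/
noncomputable def dt (u v : E2) : ℝ := u 0 * v 1 - u 1 * v 0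

/-- Open cone spanned by `u, w` (when `0 < dt u w`). -/
def cone (u w : E2) : Set E2 := {x | 0 < dt u x ∧ 0 < dt x w}

/-- The triangle `0, u, w` without two sides (when `0 < dt u w`). -/
def tri (u w : E2) : Set E2 := {x | 0 < dt u x ∧ 0 < dt x w ∧ dt u x + dt x w ≤ dt u w}

/-- coordinates -/
noncomputable def mk (p : ℝ × ℝ) : E2 := !₂[p.1, p.2]

@[simp] lemma mk_zero (p : ℝ × ℝ) : mk p 0 = p.1 := by simp [mk]
@[simp] lemma mk_one (p : ℝ × ℝ) : mk p 1 = p.2 := by simp [mk]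

lemma ext2 {x y : E2} (h0 : x 0 = y 0) (h1 : x 1 = y 1) : x = y := by
  ext i; fin_cases i <;> simpa

noncomputable def mkE : (ℝ × ℝ) ≃ᵐ E2 :=
  (MeasurableEquiv.finTwoArrow (α := ℝ)).symm.trans (MeasurableEquiv.toLp 2 (Fin 2 → ℝ))

lemma mkE_eq (p : ℝ × ℝ) : mkE p = mk p := by
  apply ext2 <;> simp [mkE, MeasurableEquiv.finTwoArrow]

lemma mk_mp : MeasurePreserving mkE := by
  exact ((volume_preserving_finTwoArrow ℝ).symm _).trans (PiLp.volume_preserving_toLp (Fin 2))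

lemma normsq (x : E2) : ‖x‖ ^ 2 = x 0 ^ 2 + x 1 ^ 2 := by
  rw [EuclideanSpace.norm_sq_eq]; simp

/-- standard triangle -/
def std : Set (ℝ × ℝ) := {p | 0 < p.1 ∧ 0 < p.2 ∧ p.1 + p.2 ≤ 1}

lemma std_meas : MeasurableSet std := by
  have : std = ({p : ℝ × ℝ | 0 < p.1} ∩ {p | 0 < p.2}) ∩ {p | p.1 + p.2 ≤ 1} := by
    ext p; simp [std, and_assoc]
  rw [this]
  exact ((measurableSet_lt measurable_const measurable_fst).inter
    (measurableSet_lt measurable_const measurable_snd)).inter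
    (measurableSet_le (measurable_fst.add measurable_snd) measurable_const)

lemma std_sub : std ⊆ Icc 0 1 ×ˢ Icc 0 1 := by
  rintro ⟨a, b⟩ ⟨h1, h2, h3⟩
  simp only at h1 h2 h3
  refine ⟨⟨?_, ?_⟩, ⟨?_, ?_⟩⟩ <;> simp only <;> linarith

lemma std_integral (k a b c : ℝ) :
    ∫ p in std, (k + a * p.1 ^ 2 + b * (p.1 * p.2) + c * p.2 ^ 2)
      = k / 2 + a / 12 + b / 24 + c / 12 := by
  set f : ℝ × ℝ → ℝ := fun p => k + a * p.1 ^ 2 + b * (p.1 * p.2) + c * p.2 ^ 2 with hf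
  have hIntg : IntegrableOn f std := by
    apply IntegrableOn.mono_set _ std_sub
    apply ContinuousOn.integrableOn_compact (isCompact_Icc.prod isCompact_Icc)
    fun_prop
  rw [← integral_indicator std_meas, Measure.volume_eq_prod, integral_prod]
  swap
  · rw [← Measure.volume_eq_prod]; exact (integrable_indicator_iff std_meas).2 hIntg
  have h1 : ∀ x : ℝ, ∫ y, std.indicator f (x, y) =
      (Ioc (0:ℝ) 1).indicator (fun x => ∫ y in (0:ℝ)..(1 - x), f (x, y)) x := by
    intro x
    by_cases hx : x ∈ Ioc (0:ℝ) 1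
    · rw [indicator_of_mem hx, intervalIntegral.integral_of_le (by linarith [hx.2]),
        ← integral_indicator measurableSet_Ioc]
      congr 1; ext y
      simp only [indicator, std, mem_ofPred_eq, mem_Ioc]
      congr 1
      apply propext
      constructor
      · rintro ⟨_, h2, h3⟩; exact ⟨h2, by linarith⟩
      · rintro ⟨h2, h3⟩; exact ⟨hx.1, h2, by linarith⟩
    · rw [indicator_of_notMem hx]
      have : ∀ y, std.indicator f (x, y) = 0 := by
        intro y
        apply indicator_of_notMem
        rintro ⟨h1, h2, h3⟩
        exact hx ⟨h1, by simp only at h1 h2 h3; linarith⟩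
      simp [this]
  refine (integral_congr_ae (Filter.Eventually.of_forall h1)).trans ?_
  rw [integral_indicator measurableSet_Ioc, ← intervalIntegral.integral_of_le zero_le_one]
  have h2 : ∀ x : ℝ, ∫ y in (0:ℝ)..(1 - x), f (x, y) =
      k * (1 - x) + a * x ^ 2 * (1 - x) + b * x * (1 - x) ^ 2 / 2 + c * (1 - x) ^ 3 / 3 := by
    intro x
    have : ∀ y ∈ uIcc (0:ℝ) (1 - x), HasDerivAt
      (fun y => (k + a * x ^ 2) * y + b * x * y ^ 2 / 2 + c * y ^ 3 / 3) (f (x, y)) y := by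
      intro y _
      have := (((hasDerivAt_id y).const_mul (k + a * x ^ 2)).add
        (((hasDerivAt_pow 2 y).const_mul (b * x)).div_const 2)).add
        (((hasDerivAt_pow 3 y).const_mul c).div_const 3)
      convert! this using 1
      simp [hf]; ring
    rw [intervalIntegral.integral_eq_sub_of_hasDerivAt this]
    · ring
    · apply Continuous.intervalIntegrable; fun_prop
  simp_rw [h2]
  have : ∀ x ∈ uIcc (0:ℝ) 1, HasDerivAt
      (fun x : ℝ => k * (x - x ^ 2 / 2) + a * (x ^ 3 / 3 - x ^ 4 / 4)
        + b / 2 * (x ^ 2 / 2 - 2 * (x ^ 3 / 3) + x ^ 4 / 4)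
        + c / 3 * (x - 3 * (x ^ 2 / 2) + x ^ 3 - x ^ 4 / 4))
      (k * (1 - x) + a * x ^ 2 * (1 - x) + b * x * (1 - x) ^ 2 / 2 + c * (1 - x) ^ 3 / 3) x := by
    intro x _
    have p1 := hasDerivAt_id x
    have p2 := hasDerivAt_pow 2 x
    have p3 := hasDerivAt_pow 3 x
    have p4 := hasDerivAt_pow 4 x
    have := ((((p1.sub (p2.div_const 2)).const_mul k).add
      (((p3.div_const 3).sub (p4.div_const 4)).const_mul a)).add
      ((((p2.div_const 2).sub ((p3.div_const 3).const_mul 2)).add (p4.div_const 4)).const_mul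
        (b / 2))).add
      ((((p1.sub ((p2.div_const 2).const_mul 3)).add p3).sub (p4.div_const 4)).const_mul (c / 3))
    convert! this using 1
    simp; ring
  rw [intervalIntegral.integral_eq_sub_of_hasDerivAt this]
  · ring
  · apply Continuous.intervalIntegrable; fun_prop

/-- linear map on the coordinate plane -/
noncomputable def lmap (u w : E2) : ℝ × ℝ →L[ℝ] ℝ × ℝ :=
  (Matrix.toLin (.finTwoProd ℝ) (.finTwoProd ℝ)
    !![u 0, w 0; u 1, w 1]).toContinuousLinearMap

lemma lmap_apply (u w : E2) (p : ℝ × ℝ) :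
    lmap u w p = (p.1 * u 0 + p.2 * w 0, p.1 * u 1 + p.2 * w 1) := by
  unfold lmap
  rw [Matrix.toLin_finTwoProd_toContinuousLinearMap]
  simp [mul_comm]

lemma lmap_det (u w : E2) : (lmap u w).det = dt u w := by
  unfold lmap
  simp only [LinearMap.det_toContinuousLinearMap, LinearMap.det_toLin,
    Matrix.det_fin_two_of, dt]
  ring

lemma tri_image (u w : E2) (h : 0 < dt u w) :
    (fun p => mkE p) ⁻¹' tri u w = lmap u w '' std := by
  ext q
  simp only [mem_preimage, mkE_eq, tri, mem_ofPred_eq, mem_image, lmap_apply, std]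
  constructor
  · rintro ⟨h1, h2, h3⟩
    refine ⟨(dt (mk q) w / dt u w, dt u (mk q) / dt u w), ⟨by positivity, by positivity, ?_⟩, ?_⟩
    · simp only; rw [← add_div, div_le_one h]; linarith
    · ext <;> simp only <;> field_simp <;> simp [dt] <;> ring
  · rintro ⟨⟨s, t⟩, ⟨h1, h2, h3⟩, rfl⟩
    simp only at h1 h2 h3
    have e1 : dt u (mk (s * u 0 + t * w 0, s * u 1 + t * w 1)) = t * dt u w := by
      simp [dt]; ring
    have e2 : dt (mk (s * u 0 + t * w 0, s * u 1 + t * w 1)) w = s * dt u w := by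
      simp [dt]; ring
    rw [e1, e2]
    refine ⟨by positivity, by positivity, by nlinarith⟩

lemma lmap_inj (u w : E2) (h : 0 < dt u w) : Function.Injective (lmap u w) := by
  rintro ⟨s, t⟩ ⟨s', t'⟩ e
  simp only [lmap_apply, Prod.mk.injEq] at e
  obtain ⟨e1, e2⟩ := e
  have a1 : (s - s') * dt u w = 0 := by
    simp only [dt]; linear_combination w 1 * e1 - w 0 * e2
  have a2 : (t - t') * dt u w = 0 := by
    simp only [dt]; linear_combination u 0 * e2 - u 1 * e1
  have b1 := (mul_eq_zero.1 a1).resolve_right h.ne'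
  have b2 := (mul_eq_zero.1 a2).resolve_right h.ne'
  ext <;> simp only <;> linarith

lemma tri_integral (u w : E2) (h : 0 < dt u w) (f : E2 → ℝ) :
    ∫ x in tri u w, f x = dt u w * ∫ p in std, f (mk (lmap u w p)) := by
  rw [← mk_mp.setIntegral_preimage_emb mkE.measurableEmbedding, tri_image u w h,
    integral_image_eq_integral_abs_det_fderiv_smul volume std_meas
      (fun x _ => (lmap u w).hasFDerivWithinAt) (lmap_inj u w h).injOn, lmap_det, abs_of_pos h,
      ← integral_const_mul]
  simp [mkE_eq]

lemma tri_moment (u w : E2) (h : 0 < dt u w) :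
    ∫ x in tri u w, ‖x‖ ^ 2 =
      dt u w / 12 * (‖u‖ ^ 2 + (u 0 * w 0 + u 1 * w 1) + ‖w‖ ^ 2) := by
  rw [tri_integral u w h]
  have : ∀ p : ℝ × ℝ, ‖mk (lmap u w p)‖ ^ 2 = 0 + ‖u‖ ^ 2 * p.1 ^ 2 +
      (2 * (u 0 * w 0 + u 1 * w 1)) * (p.1 * p.2) + ‖w‖ ^ 2 * p.2 ^ 2 := by
    intro p
    simp only [normsq, mk_zero, mk_one, lmap_apply]; ring
  simp_rw [this]
  rw [std_integral]; ring

lemma tri_area (u w : E2) (h : 0 < dt u w) : volume.real (tri u w) = dt u w / 2 := by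
  have := tri_integral u w h (fun _ => 1)
  have h2 := std_integral 1 0 0 0
  simp only [zero_mul, add_zero] at h2
  rw [h2] at this
  simpa [div_eq_mul_inv] using this

lemma dt_cont_left (u : E2) : Continuous fun x => dt x u := by unfold dt; fun_prop
lemma dt_cont_right (u : E2) : Continuous fun x => dt u x := by unfold dt; fun_prop

lemma cone_meas (u w : E2) : MeasurableSet (cone u w) :=
  ((isOpen_lt continuous_const (dt_cont_right u)).inter
    (isOpen_lt continuous_const (dt_cont_left w))).measurableSet

lemma tri_meas (u w : E2) : MeasurableSet (tri u w) := by
  have : tri u w = cone u w ∩ {x | dt u x + dt x w ≤ dt u w} := by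
    ext x; simp [tri, cone, and_assoc]
  rw [this]
  exact (cone_meas u w).inter
    (isClosed_le ((dt_cont_right u).add (dt_cont_left w)) continuous_const).measurableSet

lemma polar_rep (a b : ℝ) : ∃ θ : ℝ, a = √(a ^ 2 + b ^ 2) * cos θ ∧ b = √(a ^ 2 + b ^ 2) * sin θ ∧
    -π < θ ∧ θ ≤ π := by
  refine ⟨Complex.arg ⟨a, b⟩, ?_, ?_, Complex.neg_pi_lt_arg _, Complex.arg_le_pi _⟩
  · have := Complex.norm_mul_cos_arg ⟨a, b⟩
    rw [Complex.norm_eq_sqrt_sq_add_sq] at this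
    exact this.symm
  · have := Complex.norm_mul_sin_arg ⟨a, b⟩
    rw [Complex.norm_eq_sqrt_sq_add_sq] at this
    exact this.symm

lemma norm_eq' (x : E2) : ‖x‖ = √(x 0 ^ 2 + x 1 ^ 2) := by
  rw [← normsq, sqrt_sq (norm_nonneg _)]

lemma sector (u w : E2) (h : 0 < dt u w) : ∃ x, 0 < x ∧ x < π ∧ dt u w = ‖u‖ * ‖w‖ * sin x ∧
    u 0 * w 0 + u 1 * w 1 = ‖u‖ * ‖w‖ * cos x ∧
    x / 2 ≤ volume.real (cone u w ∩ Metric.ball 0 1) := by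
  obtain ⟨α, hu0, hu1, -, -⟩ := polar_rep (u 0) (u 1)
  obtain ⟨x, hx0, hx1, hx2, hx3⟩ := polar_rep (u 0 * w 0 + u 1 * w 1) (dt u w)
  have hn : √((u 0 * w 0 + u 1 * w 1) ^ 2 + dt u w ^ 2) = ‖u‖ * ‖w‖ := by
    rw [norm_eq' u, norm_eq' w, ← sqrt_mul (by positivity)]
    congr 1; simp only [dt]; ring
  rw [hn] at hx0 hx1
  rw [← norm_eq'] at hu0 hu1
  have hu : 0 < ‖u‖ := by
    rcases (norm_nonneg u).eq_or_lt with h0 | h0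
    · rw [← h0] at hx1; simp at hx1; linarith
    · exact h0
  have hw : 0 < ‖w‖ := by
    rcases (norm_nonneg w).eq_or_lt with h0 | h0
    · rw [← h0] at hx1; simp at hx1; linarith
    · exact h0
  have hs : 0 < sin x := by
    by_contra hc
    push Not at hc
    have : 0 < ‖u‖ * ‖w‖ := by positivity
    nlinarith
  have hxpos : 0 < x := by
    by_contra hc
    push Not at hc
    linarith [sin_nonpos_of_nonpos_of_neg_pi_le hc hx2.le]
  have hxpi : x < π := by
    rcases hx3.eq_or_lt with h0 | h0
    · rw [h0, sin_pi] at hs; linarith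
    · exact h0
  refine ⟨x, hxpos, hxpi, hx1, hx0, ?_⟩
  have hw0 : w 0 = ‖w‖ * cos (α + x) := by
    have : ‖u‖ ^ 2 * w 0 = ‖u‖ ^ 2 * (‖w‖ * cos (α + x)) := by
      rw [cos_add]
      have e : ‖u‖ ^ 2 * w 0 = (u 0 * w 0 + u 1 * w 1) * u 0 - dt u w * u 1 := by
        rw [normsq]; simp only [dt]; ring
      rw [e, hx0, hx1]
      linear_combination ‖u‖ * ‖w‖ * cos x * hu0 - ‖u‖ * ‖w‖ * sin x * hu1
    exact mul_left_cancel₀ (by positivity) this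
  have hw1 : w 1 = ‖w‖ * sin (α + x) := by
    have : ‖u‖ ^ 2 * w 1 = ‖u‖ ^ 2 * (‖w‖ * sin (α + x)) := by
      rw [sin_add]
      have e : ‖u‖ ^ 2 * w 1 = (u 0 * w 0 + u 1 * w 1) * u 1 + dt u w * u 0 := by
        rw [normsq]; simp only [dt]; ring
      rw [e, hx0, hx1]
      linear_combination ‖u‖ * ‖w‖ * cos x * hu1 + ‖u‖ * ‖w‖ * sin x * hu0
    exact mul_left_cancel₀ (by positivity) this
  set S : Set (ℝ × ℝ) := Ioo 0 1 ×ˢ Ioo α (α + x) with hS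
  have hSm : MeasurableSet S := measurableSet_Ioo.prod measurableSet_Ioo
  have hinj : InjOn polarCoord.symm S := by
    rintro ⟨r, θ⟩ ⟨⟨hr, hr'⟩, ⟨h1, h2⟩⟩ ⟨r', θ'⟩ ⟨⟨hr2, hr2'⟩, ⟨h12, h22⟩⟩ e
    simp only [polarCoord_symm_apply, Prod.mk.injEq] at *
    obtain ⟨e1, e2⟩ := e
    have hrr : r = r' := by
      have : r ^ 2 = r' ^ 2 := by
        have a1 := sin_sq_add_cos_sq θ
        have a2 := sin_sq_add_cos_sq θ'
        calc r ^ 2 = (r * cos θ) ^ 2 + (r * sin θ) ^ 2 := by linear_combination - r ^ 2 * a1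
          _ = r' ^ 2 := by rw [e1, e2]; linear_combination r' ^ 2 * a2
      exact (pow_left_inj₀ hr.le hr2.le (by norm_num)).1 this
    subst hrr
    refine ⟨rfl, ?_⟩
    have c1 := mul_left_cancel₀ hr.ne' e1
    have c2 := mul_left_cancel₀ hr.ne' e2
    have : cos (θ - θ') = 1 := by
      rw [cos_sub, c1, c2]; nlinarith [sin_sq_add_cos_sq θ']
    have := (cos_eq_one_iff_of_lt_of_lt (by linarith) (by linarith)).1 this
    linarith
  have hsub : polarCoord.symm '' S ⊆ mkE ⁻¹' (cone u w ∩ Metric.ball 0 1) := by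
    rintro _ ⟨⟨r, θ⟩, ⟨⟨hr, hr'⟩, ⟨h1, h2⟩⟩, rfl⟩
    simp only at hr hr' h1 h2
    rw [mem_preimage, mkE_eq, polarCoord_symm_apply]
    refine ⟨⟨?_, ?_⟩, ?_⟩
    · have : dt u (mk (r * cos θ, r * sin θ)) = ‖u‖ * r * sin (θ - α) := by
        rw [dt, mk_zero, mk_one, sin_sub]
        linear_combination r * sin θ * hu0 - r * cos θ * hu1
      simp only
      rw [this]
      have := sin_pos_of_pos_of_lt_pi (x := θ - α) (by linarith) (by linarith)
      positivity
    · have : dt (mk (r * cos θ, r * sin θ)) w = ‖w‖ * r * sin (α + x - θ) := by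
        rw [dt, mk_zero, mk_one, sin_sub]
        linear_combination r * cos θ * hw1 - r * sin θ * hw0
      simp only
      rw [this]
      have := sin_pos_of_pos_of_lt_pi (x := α + x - θ) (by linarith) (by linarith)
      positivity
    · rw [mem_ball_zero_iff, norm_eq', mk_zero, mk_one]
      have : (r * cos θ) ^ 2 + (r * sin θ) ^ 2 = r ^ 2 := by
        linear_combination r ^ 2 * sin_sq_add_cos_sq θ
      simp only
      rw [this, sqrt_sq hr.le]; exact hr'
  have hvol : volume.real (polarCoord.symm '' S) = x / 2 := by
    have := integral_image_eq_integral_abs_det_fderiv_smul volume hSm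
      (fun p _ => (hasFDerivAt_polarCoord_symm p).hasFDerivWithinAt) hinj (fun _ => (1:ℝ))
    simp only [det_fderivPolarCoordSymm, smul_eq_mul, mul_one, integral_const,
      measureReal_restrict_apply_univ] at this
    rw [this]
    have e1 : ∫ p in S, |p.1| = ∫ p in S, p.1 * (1:ℝ) := by
      apply setIntegral_congr_fun hSm
      rintro ⟨r, θ⟩ ⟨⟨hr, hr'⟩, _⟩
      simp only at hr ⊢
      rw [abs_of_pos hr, mul_one]
    rw [e1, hS, Measure.volume_eq_prod, setIntegral_prod_mul (fun r : ℝ => r) (fun _ : ℝ => (1:ℝ)),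
      ← integral_Ioc_eq_integral_Ioo, ← intervalIntegral.integral_of_le zero_le_one]
    simp [hxpos.le]
    ring
  have hpre : volume.real (mkE ⁻¹' (cone u w ∩ Metric.ball 0 1)) =
      volume.real (cone u w ∩ Metric.ball 0 1) := by
    simp only [Measure.real]
    rw [mk_mp.measure_preimage ((cone_meas u w).inter measurableSet_ball).nullMeasurableSet]
  rw [← hpre, ← hvol]
  refine measureReal_mono hsub ?_
  rw [mk_mp.measure_preimage ((cone_meas u w).inter measurableSet_ball).nullMeasurableSet]
  exact ((measure_mono inter_subset_right).trans_lt measure_ball_lt_top).ne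

/-- Hypotheses under which the polygon is decomposed into triangles around the origin. -/
structure Good (V : Finset E2) (P : Set E2) : Prop where
  hP : P = convexHull ℝ (V : Set E2)
  ext : ∀ v ∈ V, v ∈ P.extremePoints ℝ
  pos : ∀ x : E2, x ≠ 0 → ∃ v ∈ V, 0 < dt x v
  zero : (0 : E2) ∈ P

open Classical in
/-- Counterclockwise oriented edges of the convex hull. -/
noncomputable def edges (V : Finset E2) : Finset (E2 × E2) :=
  (V ×ˢ V).filter (fun e => e.1 ≠ e.2 ∧ ∀ v ∈ V, dt e.1 v + dt v e.2 ≤ dt e.1 e.2)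

lemma mem_edges {V : Finset E2} {e : E2 × E2} : e ∈ edges V ↔ e.1 ∈ V ∧ e.2 ∈ V ∧ e.1 ≠ e.2 ∧
    ∀ v ∈ V, dt e.1 v + dt v e.2 ≤ dt e.1 e.2 := by
  simp [edges, and_assoc]

lemma dt_swap (u v : E2) : dt u v = - dt v u := by simp only [dt]; ring
lemma dt_self (u : E2) : dt u u = 0 := by simp only [dt]; ring
lemma dt_add_left (a b c : E2) : dt (a + b) c = dt a c + dt b c := by simp [dt]; ring
lemma dt_add_right (a b c : E2) : dt c (a + b) = dt c a + dt c b := by simp [dt]; ring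
lemma dt_sub_left (a b c : E2) : dt (a - b) c = dt a c - dt b c := by simp [dt]; ring
lemma dt_neg_left (a c : E2) : dt (-a) c = - dt a c := by simp [dt]; ring
lemma dt_smul_left (r : ℝ) (a c : E2) : dt (r • a) c = r * dt a c := by simp [dt]; ring
lemma dt_smul_right (r : ℝ) (a c : E2) : dt c (r • a) = r * dt c a := by simp [dt]; ring

lemma decomp (u w x : E2) (h : dt u w ≠ 0) :
    x = (dt x w / dt u w) • u + (dt u x / dt u w) • w := by
  apply ext2 <;> simp <;> field_simp <;> simp only [dt] <;> ring

variable {V : Finset E2} {P : Set E2}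

lemma Good.edge_pos (G : Good V P) {e : E2 × E2} (he : e ∈ edges V) : 0 < dt e.1 e.2 := by
  obtain ⟨h1, h2, h3, h4⟩ := mem_edges.1 he
  obtain ⟨v, hv, hv'⟩ := G.pos (e.1 - e.2) (sub_ne_zero.2 h3)
  rw [dt_sub_left, dt_swap e.2 v] at hv'
  linarith [h4 v hv]

lemma Good.sub (G : Good V P) {v : E2} (hv : v ∈ V) : v ∈ P := by
  rw [G.hP]; exact subset_convexHull ℝ _ hv

lemma Good.convex (G : Good V P) : Convex ℝ P := by
  rw [G.hP]; exact convex_convexHull ℝ _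

lemma Good.compact (G : Good V P) : IsCompact P := by
  rw [G.hP]; exact V.finite_toSet.isCompact_convexHull ℝ

lemma Good.edge_le (G : Good V P) {e : E2 × E2} (he : e ∈ edges V) {x : E2} (hx : x ∈ P) :
    dt e.1 x + dt x e.2 ≤ dt e.1 e.2 := by
  obtain ⟨h1, h2, h3, h4⟩ := mem_edges.1 he
  rw [G.hP] at hx
  have : convexHull ℝ (V : Set E2) ⊆ {x | dt e.1 x + dt x e.2 ≤ dt e.1 e.2} := by
    apply convexHull_min
    · intro v hv; exact h4 v hv
    · apply convex_halfSpace_le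
      constructor
      · intro a b; rw [dt_add_right, dt_add_left]; ring
      · intro r a; rw [dt_smul_right, dt_smul_left, smul_eq_mul]; ring
  exact this hx

lemma Good.tri_subset (G : Good V P) {e : E2 × E2} (he : e ∈ edges V) : tri e.1 e.2 ⊆ P := by
  rintro x ⟨h1, h2, h3⟩
  obtain ⟨m1, m2, -, -⟩ := mem_edges.1 he
  have hp := G.edge_pos he
  rw [decomp e.1 e.2 x hp.ne']
  set a := dt x e.2 / dt e.1 e.2
  set b := dt e.1 x / dt e.1 e.2
  have ha : 0 < a := by positivity
  have hb : 0 < b := by positivity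
  have hab : a + b ≤ 1 := by
    simp only [a, b]
    rw [← add_div, div_le_one hp]; linarith
  have hy : (a / (a + b)) • e.1 + (b / (a + b)) • e.2 ∈ P :=
    G.convex (G.sub m1) (G.sub m2) (by positivity) (by positivity) (by field_simp)
  have := G.convex.smul_mem_of_zero_mem G.zero hy (t := a + b) ⟨by positivity, hab⟩
  convert this using 1
  rw [smul_add, smul_smul, smul_smul]
  congr 2 <;> field_simp

lemma ext_seg {p a b : E2} (hp : p ∈ P.extremePoints ℝ) (ha : a ∈ P) (hb : b ∈ P)
    (t : ℝ) (h0 : 0 < t) (h1 : t < 1) (h : p = a + t • (b - a)) : a = b := by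
  rw [mem_extremePoints] at hp
  have hs : p ∈ openSegment ℝ a b := by
    refine ⟨1 - t, t, by linarith, h0, by ring, ?_⟩
    rw [h, sub_smul, smul_sub, one_smul]; abel
  have := hp.2 a ha b hb hs
  rw [this.1, this.2]

lemma collinear_ne {u v w : E2} (hu : u ∈ P.extremePoints ℝ) (hv : v ∈ P.extremePoints ℝ)
    (hw : w ∈ P.extremePoints ℝ) (huv : u ≠ v) (huw : u ≠ w) (hvw : v ≠ w) :
    dt u v + dt v w ≠ dt u w := by
  intro h
  have hd : w - u ≠ 0 := sub_ne_zero.2 huw.symm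
  have hn : 0 < ‖w - u‖ ^ 2 := by positivity
  rw [normsq] at hn
  simp only [PiLp.sub_apply] at hn
  simp only [dt] at h
  obtain ⟨τ, hτ⟩ : ∃ τ : ℝ, v = u + τ • (w - u) := by
    refine ⟨((w 0 - u 0) * (v 0 - u 0) + (w 1 - u 1) * (v 1 - u 1)) /
      ((w 0 - u 0) ^ 2 + (w 1 - u 1) ^ 2), ?_⟩
    apply ext2
    · simp only [PiLp.add_apply, PiLp.smul_apply, PiLp.sub_apply, smul_eq_mul]
      field_simp
      linear_combination (w 1 - u 1) * h
    · simp only [PiLp.add_apply, PiLp.smul_apply, PiLp.sub_apply, smul_eq_mul]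
      field_simp
      linear_combination -(w 0 - u 0) * h
  have t0 : τ ≠ 0 := by rintro rfl; apply huv; simp [hτ]
  have t1 : τ ≠ 1 := by rintro rfl; apply hvw; simp [hτ]
  rcases lt_or_gt_of_ne t0 with h0 | h0
  · -- u between v and w
    apply hvw
    apply ext_seg hu hv.1 hw.1 (-τ / (1 - τ)) (div_pos (by linarith) (by linarith))
      ((div_lt_one (by linarith)).2 (by linarith))
    have : 1 - τ ≠ 0 := by linarith
    rw [hτ]
    apply ext2 <;> simp <;> field_simp <;> ring
  rcases lt_or_gt_of_ne t1 with h1 | h1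
  · exact huw (ext_seg hv hu.1 hw.1 τ h0 h1 hτ)
  · apply huv
    apply ext_seg hw hu.1 hv.1 (1 / τ) (by positivity) ((div_lt_one h0).2 h1)
    rw [hτ]
    apply ext2 <;> simp <;> field_simp <;> ring

lemma Good.edge_unique (G : Good V P) {u w w' : E2} (h : (u, w) ∈ edges V)
    (h' : (u, w') ∈ edges V) : w = w' := by
  by_contra hne
  obtain ⟨a1, a2, a3, a4⟩ := mem_edges.1 h
  obtain ⟨b1, b2, b3, b4⟩ := mem_edges.1 h'
  simp only at *
  have c1 := a4 w' b2
  have c2 := b4 w a2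
  rw [dt_swap w w'] at c2
  exact collinear_ne (G.ext u a1) (G.ext w' b2) (G.ext w a2) b3 a3 (Ne.symm hne) (by linarith)

lemma Good.card_edges (G : Good V P) : (edges V).card ≤ V.card := by
  apply Finset.card_le_card_of_injOn (fun e => e.1)
  · intro e he; exact (mem_edges.1 he).1
  · rintro ⟨u, w⟩ h ⟨u', w'⟩ h' e
    simp only at e
    subst e
    rw [G.edge_unique h h']

lemma Good.cone_disjoint (G : Good V P) {e e' : E2 × E2} (he : e ∈ edges V) (he' : e' ∈ edges V)
    (hne : e ≠ e') : Disjoint (cone e.1 e.2) (cone e'.1 e'.2) := by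
  rw [Set.disjoint_left]
  rintro x ⟨h1, h2⟩ ⟨h1', h2'⟩
  apply hne
  have hp := G.edge_pos he
  have hp' := G.edge_pos he'
  obtain ⟨u, w⟩ := e
  obtain ⟨u', w'⟩ := e'
  obtain ⟨a1, a2, a3, a4⟩ := mem_edges.1 he
  obtain ⟨b1, b2, b3, b4⟩ := mem_edges.1 he'
  simp only at *
  have d := decomp u w x hp.ne'
  have d' := decomp u' w' x hp'.ne'
  set s := dt x w / dt u w
  set t := dt u x / dt u w
  set s' := dt x w' / dt u' w'
  set t' := dt u' x / dt u' w'
  have hs : 0 < s := by positivity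
  have ht : 0 < t := by positivity
  have hs' : 0 < s' := by positivity
  have ht' : 0 < t' := by positivity
  -- values of the two functionals
  have f1 : dt u x + dt x w = (s + t) * dt u w := by simp only [s, t]; field_simp; ring
  have f1' : dt u' x + dt x w' = (s' + t') * dt u' w' := by simp only [s', t']; field_simp; ring
  have g1 : dt u x + dt x w = s' * (dt u u' + dt u' w) + t' * (dt u w' + dt w' w) := by
    rw [d', dt_add_right, dt_add_left]; simp only [dt_smul_right, dt_smul_left]; ring
  have g1' : dt u' x + dt x w' = s * (dt u' u + dt u w') + t * (dt u' w + dt w w') := by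
    rw [d, dt_add_right, dt_add_left]; simp only [dt_smul_right, dt_smul_left]; ring
  have k1 := a4 u' b1
  have k2 := a4 w' b2
  have k1' := b4 u a1
  have k2' := b4 w a2
  have l1 : s + t ≤ s' + t' := by
    have : (s + t) * dt u w ≤ (s' + t') * dt u w := by
      rw [← f1, g1]; nlinarith
    exact le_of_mul_le_mul_right this hp
  have l2 : s' + t' ≤ s + t := by
    have : (s' + t') * dt u' w' ≤ (s + t) * dt u' w' := by
      rw [← f1', g1']; nlinarith
    exact le_of_mul_le_mul_right this hp'
  have l3 : s + t = s' + t' := le_antisymm l1 l2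
  have key : s' * (dt u w - (dt u u' + dt u' w)) + t' * (dt u w - (dt u w' + dt w' w)) = 0 := by
    have := f1.symm.trans g1
    rw [l3] at this
    linarith
  have n1 : 0 ≤ s' * (dt u w - (dt u u' + dt u' w)) := mul_nonneg hs'.le (by linarith)
  have n2 : 0 ≤ t' * (dt u w - (dt u w' + dt w' w)) := mul_nonneg ht'.le (by linarith)
  have z1 : dt u w - (dt u u' + dt u' w) = 0 :=
    (mul_eq_zero.1 (by linarith : s' * (dt u w - (dt u u' + dt u' w)) = 0)).resolve_left hs'.ne'
  have z2 : dt u w - (dt u w' + dt w' w) = 0 :=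
    (mul_eq_zero.1 (by linarith : t' * (dt u w - (dt u w' + dt w' w)) = 0)).resolve_left ht'.ne'
  have m1 : u' = u ∨ u' = w := by
    by_contra hc
    push Not at hc
    exact collinear_ne (G.ext u a1) (G.ext u' b1) (G.ext w a2) hc.1.symm a3 hc.2 (by linarith)
  have m2 : w' = u ∨ w' = w := by
    by_contra hc
    push Not at hc
    exact collinear_ne (G.ext u a1) (G.ext w' b2) (G.ext w a2) hc.1.symm a3 hc.2 (by linarith)
  rcases m1 with rfl | rfl
  · rcases m2 with rfl | rfl
    · exact absurd rfl b3
    · rfl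
  · rcases m2 with rfl | rfl
    · rw [dt_swap] at hp'; linarith
    · exact absurd rfl b3

lemma Good.cover (G : Good V P) {x : E2} (hx : x ≠ 0) (hg : ∀ v ∈ V, v ≠ 0 → dt x v ≠ 0) :
    ∃ e ∈ edges V, x ∈ cone e.1 e.2 := by
  classical
  let Q := (V ×ˢ V).filter (fun e => 0 < dt e.1 x ∧ 0 < dt x e.2)
  have hQ : Q.Nonempty := by
    obtain ⟨w, hw, hw'⟩ := G.pos x hx
    obtain ⟨u, hu, hu'⟩ := G.pos (-x) (neg_ne_zero.2 hx)
    rw [dt_neg_left, ← dt_swap] at hu'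
    exact ⟨(u, w), by simp [Q, hu, hw, hu', hw']⟩
  obtain ⟨⟨u, w⟩, he, hmax⟩ := Finset.exists_max_image Q
    (fun e => dt e.1 e.2 / (dt e.1 x + dt x e.2)) hQ
  simp only [Q, Finset.mem_filter, Finset.mem_product, and_imp, Prod.forall] at he hmax
  obtain ⟨⟨hu, hw⟩, hp, hq⟩ := he
  have main : ∀ v ∈ V, v ≠ 0 → dt u v + dt v w ≤ dt u w := by
    intro v hv hv0
    by_contra hc
    push Not at hc
    rcases lt_or_gt_of_ne (hg v hv hv0) with h | h
    · have hvx : 0 < dt v x := by rw [dt_swap]; linarith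
      have := hmax v w hv hw hvx hq
      rw [div_le_div_iff₀ (by positivity) (by positivity)] at this
      have id : dt v w * (dt u x + dt x w) - dt u w * (dt v x + dt x w)
          = dt x w * (dt u v + dt v w - dt u w) := by simp only [dt]; ring
      have : 0 < dt x w * (dt u v + dt v w - dt u w) := mul_pos hq (by linarith)
      linarith
    · have := hmax u v hu hv hp h
      rw [div_le_div_iff₀ (by positivity) (by positivity)] at this
      have id : dt u v * (dt u x + dt x w) - dt u w * (dt u x + dt x v)
          = dt u x * (dt u v + dt v w - dt u w) := by simp only [dt]; ring
      have : 0 < dt u x * (dt u v + dt v w - dt u w) := mul_pos hp (by linarith)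
      linarith
  have hne : u ≠ w := by
    rintro rfl; rw [dt_swap] at hp; linarith
  have hpos : 0 < dt u w := by
    obtain ⟨v, hv, hv'⟩ := G.pos (u - w) (sub_ne_zero.2 hne)
    have hv0 : v ≠ 0 := by rintro rfl; simp [dt] at hv'
    have := main v hv hv0
    rw [dt_sub_left, dt_swap w v] at hv'
    linarith
  refine ⟨(u, w), mem_edges.2 ⟨hu, hw, hne, ?_⟩, hp, hq⟩
  intro v hv
  by_cases hv0 : v = 0
  · subst hv0; simp only; simp only [dt] at hpos ⊢; simp; linarith
  · exact main v hv hv0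

lemma line_null (v : E2) (hv : v ≠ 0) : volume {x : E2 | dt x v = 0} = 0 := by
  let L : E2 →ₗ[ℝ] ℝ := IsLinearMap.mk' (fun x => dt x v)
    ⟨fun a b => dt_add_left a b v, fun r a => dt_smul_left r a v⟩
  have h1 : {x : E2 | dt x v = 0} = (LinearMap.ker L : Set E2) := by
    ext x; simp [L]
  rw [h1]
  apply Measure.addHaar_submodule
  rw [Ne, LinearMap.ker_eq_top]
  intro h
  apply hv
  have e1 : dt (mk (1, 0)) v = 0 := by
    have : L (mk (1, 0)) = 0 := by rw [h]; rfl
    simpa [L] using this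
  have e2 : dt (mk (0, 1)) v = 0 := by
    have : L (mk (0, 1)) = 0 := by rw [h]; rfl
    simpa [L] using this
  simp [dt] at e1 e2
  apply ext2 <;> simp [e1, e2]

lemma Good.ae_eq (G : Good V P) : P =ᵐ[volume] ⋃ e ∈ edges V, tri e.1 e.2 := by
  have hsub : (⋃ e ∈ edges V, tri e.1 e.2) ⊆ P :=
    iUnion₂_subset fun e he => G.tri_subset he
  apply Filter.EventuallyLE.antisymm _ hsub.eventuallyLE
  rw [ae_le_set]
  apply measure_mono_null (t := {0} ∪ ⋃ v ∈ V.filter (fun v => v ≠ 0), {x : E2 | dt x v = 0})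
  · rintro x ⟨hx, hx'⟩
    by_contra hc
    simp only [mem_union, mem_singleton_iff, mem_iUnion, not_or, not_exists] at hc
    obtain ⟨e, he, hxe⟩ := G.cover hc.1 (fun v hv hv0 h => hc.2 v (by simp [hv, hv0]) h)
    apply hx'
    simp only [mem_iUnion]
    exact ⟨e, he, hxe.1, hxe.2, G.edge_le he hx⟩
  · rw [measure_union_null_iff]
    refine ⟨measure_singleton _, ?_⟩
    refine (measure_biUnion_null_iff
      (Finset.countable_toSet (V.filter (fun v => v ≠ 0)))).2 ?_
    intro v hv
    exact line_null v (by simp at hv; exact hv.2)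

lemma tri_sub_cone (u w : E2) : tri u w ⊆ cone u w := fun _ hx => ⟨hx.1, hx.2.1⟩

lemma Good.integral (G : Good V P) (f : E2 → ℝ) (hf : Continuous f) :
    ∫ x in P, f x = ∑ e ∈ edges V, ∫ x in tri e.1 e.2, f x := by
  rw [setIntegral_congr_set G.ae_eq]
  apply integral_biUnion_finset
  · intro e _; exact tri_meas _ _
  · intro e he e' he' hne
    exact (G.cone_disjoint he he' hne).mono (tri_sub_cone _ _) (tri_sub_cone _ _)
  · intro e he
    exact (hf.continuousOn.integrableOn_compact G.compact).mono_set (G.tri_subset he)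

lemma Good.area (G : Good V P) : volume.real P = ∑ e ∈ edges V, dt e.1 e.2 / 2 := by
  have := G.integral (fun _ => 1) continuous_const
  simp only [integral_const, measureReal_restrict_apply_univ, smul_eq_mul, mul_one] at this
  rw [this]
  exact Finset.sum_congr rfl fun e he => tri_area _ _ (G.edge_pos he)

lemma Good.moment (G : Good V P) : ∫ x in P, ‖x‖ ^ 2 = ∑ e ∈ edges V,
    dt e.1 e.2 / 12 * (‖e.1‖ ^ 2 + (e.1 0 * e.2 0 + e.1 1 * e.2 1) + ‖e.2‖ ^ 2) := by
  rw [G.integral _ (by fun_prop)]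
  exact Finset.sum_congr rfl fun e he => tri_moment _ _ (G.edge_pos he)

lemma Good.angle (G : Good V P) :
    ∑ e ∈ edges V, volume.real (cone e.1 e.2 ∩ Metric.ball 0 1) ≤ π := by
  rw [← measureReal_biUnion_finset]
  · have hb : volume.real (Metric.ball (0 : E2) 1) = π := by
      simp [Measure.real, pi_nonneg]
    rw [← hb]
    refine measureReal_mono (iUnion₂_subset fun e _ => inter_subset_right) measure_ball_lt_top.ne
  · intro e he e' he' hne
    exact (G.cone_disjoint he he' hne).mono inter_subset_left inter_subset_left
  · intro e _; exact (cone_meas _ _).inter measurableSet_ball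

lemma g_deriv (x : ℝ) : HasDerivAt (fun x => sin x / (2 + cos x))
    ((2 * cos x + 1) / (2 + cos x) ^ 2) x := by
  have hp : 2 + cos x ≠ 0 := by linarith [neg_one_le_cos x]
  have := (hasDerivAt_sin x).div ((hasDerivAt_cos x).const_add 2) hp
  convert! this using 1
  congr 1
  linear_combination - sin_sq_add_cos_sq x

lemma phi_mono {c d : ℝ} (hc : -1 ≤ c) (hcd : c ≤ d) (hd : d ≤ 1) :
    (2 * c + 1) / (2 + c) ^ 2 ≤ (2 * d + 1) / (2 + d) ^ 2 := by
  rw [div_le_div_iff₀ (by nlinarith) (by nlinarith)]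
  have h : 0 ≤ (d - c) * (4 - 2 * (c * d) - c - d) := by
    apply mul_nonneg (by linarith)
    nlinarith [mul_nonneg (by linarith : 0 ≤ c + 1) (by linarith : 0 ≤ 1 - d),
      mul_nonneg (by linarith : 0 ≤ 1 - c) (by linarith : 0 ≤ 1 - d)]
  nlinarith

lemma tangent {x x0 : ℝ} (hx : 0 ≤ x) (hx' : x ≤ π) (h0 : 0 ≤ x0) (h0' : x0 ≤ π) :
    sin x / (2 + cos x) ≤ sin x0 / (2 + cos x0) +
      (2 * cos x0 + 1) / (2 + cos x0) ^ 2 * (x - x0) := by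
  have hcont : ∀ s, ContinuousOn (fun x => sin x / (2 + cos x)) s :=
    fun s y _ => (g_deriv y).continuousAt.continuousWithinAt
  rcases lt_trichotomy x x0 with h | h | h
  · obtain ⟨y, hy, e⟩ := exists_hasDerivAt_eq_slope _ _ h (hcont _) (fun y _ => g_deriv y)
    have := phi_mono (neg_one_le_cos x0) (cos_le_cos_of_nonneg_of_le_pi (by linarith [hy.1]) h0'
      hy.2.le) (cos_le_one y)
    rw [eq_div_iff (by linarith)] at e
    nlinarith
  · subst h; simp
  · obtain ⟨y, hy, e⟩ := exists_hasDerivAt_eq_slope _ _ h (hcont _) (fun y _ => g_deriv y)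
    have := phi_mono (neg_one_le_cos y) (cos_le_cos_of_nonneg_of_le_pi h0 (by linarith [hy.2])
      hy.1.le) (cos_le_one x0)
    rw [eq_div_iff (by linarith)] at e
    nlinarith

lemma cFun_eq (n : ℕ) (hn : 3 ≤ n) :
    cFun n = (2 + cos (2 * π / n)) / (3 * n * sin (2 * π / n)) := by
  have hn' : (3:ℝ) ≤ n := by exact_mod_cast hn
  have hn0 : (0:ℝ) < n := by linarith
  have hpos : 0 < π / n := by positivity
  have hlt : π / n < π / 2 := by
    apply div_lt_div_of_pos_left pi_pos (by norm_num) (by linarith)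
  have hs : 0 < sin (π / n) := sin_pos_of_pos_of_lt_pi hpos (by linarith [pi_pos])
  have hc : 0 < cos (π / n) := cos_pos_of_mem_Ioo ⟨by linarith [pi_pos], hlt⟩
  have h2 : 2 * π / n = 2 * (π / n) := by ring
  rw [cFun, h2, sin_two_mul, cos_two_mul, tan_eq_sin_div_cos, cot_eq_cos_div_sin]
  field_simp
  linear_combination sin_sq_add_cos_sq (π / n)

lemma Good.lower (G : Good V P) (n : ℕ) (hn : 3 ≤ n) (hV : V.card ≤ n) (h1 : volume.real P = 1) :
    cFun n ≤ ∫ x in P, ‖x‖ ^ 2 := by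
  have hn' : (3:ℝ) ≤ n := by exact_mod_cast hn
  have hn0 : (0:ℝ) < n := by linarith
  set x0 := 2 * π / n with hx0
  have hx0pos : 0 < x0 := by positivity
  have hx0le : x0 ≤ 2 * π / 3 := by
    apply div_le_div_of_nonneg_left (by positivity) (by norm_num) hn'
  have hpi := pi_pos
  have hs0 : 0 < sin x0 := sin_pos_of_pos_of_lt_pi hx0pos (by linarith)
  have hc0 : -(1/2) ≤ cos x0 := by
    have : cos (2 * π / 3) ≤ cos x0 :=
      cos_le_cos_of_nonneg_of_le_pi hx0pos.le (by linarith) hx0le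
    have e : cos (2 * π / 3) = -(1/2) := by
      rw [show 2 * π / 3 = π - π / 3 by ring, cos_pi_sub, cos_pi_div_three]
    linarith
  set g0 := sin x0 / (2 + cos x0) with hg0
  set k := (2 * cos x0 + 1) / (2 + cos x0) ^ 2 with hk
  have hk0 : 0 ≤ k := div_nonneg (by linarith) (by positivity)
  have ht0 : 0 ≤ g0 - k * x0 := by
    have := tangent le_rfl hpi.le hx0pos.le (by linarith : x0 ≤ π)
    simp only [sin_zero, zero_div] at this
    linarith
  set c := cFun n with hc
  have hcg : 3 * c * n * g0 = 1 := by
    rw [hc, cFun_eq n hn, hg0, ← hx0]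
    have : 2 + cos x0 ≠ 0 := by linarith
    field_simp
  have hedge : ∀ e ∈ edges V, 2 * c * (dt e.1 e.2 / 2) - 3 * c ^ 2 * (g0 - k * x0
      + 2 * k * volume.real (cone e.1 e.2 ∩ Metric.ball 0 1)) ≤
      dt e.1 e.2 / 12 * (‖e.1‖ ^ 2 + (e.1 0 * e.2 0 + e.1 1 * e.2 1) + ‖e.2‖ ^ 2) := by
    intro e he
    have hp := G.edge_pos he
    obtain ⟨x, hx, hxpi, hd, hi, hv⟩ := sector e.1 e.2 hp
    set vol := volume.real (cone e.1 e.2 ∩ Metric.ball 0 1)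
    have ht := tangent hx.le hxpi.le hx0pos.le (by linarith : x0 ≤ π)
    have hsx := sin_pos_of_pos_of_lt_pi hx hxpi
    have hcx : 0 < 2 + cos x := by linarith [neg_one_le_cos x]
    have s1 : 3 * c ^ 2 * (sin x / (2 + cos x)) ≤ 3 * c ^ 2 * (g0 - k * x0 + 2 * k * vol) := by
      apply mul_le_mul_of_nonneg_left _ (by positivity)
      have : k * x ≤ k * (2 * vol) := mul_le_mul_of_nonneg_left (by linarith) hk0
      nlinarith
    have s2 : dt e.1 e.2 / 12 * (‖e.1‖ * ‖e.2‖ * (2 + cos x)) ≤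
        dt e.1 e.2 / 12 * (‖e.1‖ ^ 2 + (e.1 0 * e.2 0 + e.1 1 * e.2 1) + ‖e.2‖ ^ 2) := by
      apply mul_le_mul_of_nonneg_left _ (by positivity)
      rw [hi]
      nlinarith [sq_nonneg (‖e.1‖ - ‖e.2‖)]
    have s3 : 0 ≤ dt e.1 e.2 / 12 * (‖e.1‖ * ‖e.2‖ * (2 + cos x)) - 2 * c * (dt e.1 e.2 / 2)
        + 3 * c ^ 2 * (sin x / (2 + cos x)) := by
      rw [hd]
      have : ‖e.1‖ * ‖e.2‖ * sin x / 12 * (‖e.1‖ * ‖e.2‖ * (2 + cos x))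
          - 2 * c * (‖e.1‖ * ‖e.2‖ * sin x / 2) + 3 * c ^ 2 * (sin x / (2 + cos x))
          = sin x / (12 * (2 + cos x)) * (‖e.1‖ * ‖e.2‖ * (2 + cos x) - 6 * c) ^ 2 := by
        field_simp; ring
      rw [this]; positivity
    linarith
  have hsum := Finset.sum_le_sum hedge
  rw [← G.moment, Finset.sum_sub_distrib, ← Finset.mul_sum, ← Finset.mul_sum, ← G.area, h1,
    Finset.sum_add_distrib, Finset.sum_const, nsmul_eq_mul, ← Finset.mul_sum] at hsum
  have hang := G.angle
  have hm : ((edges V).card : ℝ) ≤ n := by exact_mod_cast G.card_edges.trans hV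
  have b1 : ((edges V).card : ℝ) * (g0 - k * x0) ≤ n * (g0 - k * x0) :=
    mul_le_mul_of_nonneg_right hm ht0
  have b2 : 2 * k * ∑ e ∈ edges V, volume.real (cone e.1 e.2 ∩ Metric.ball 0 1) ≤ 2 * k * π :=
    mul_le_mul_of_nonneg_left hang (by positivity)
  have hnx : n * x0 = 2 * π := by rw [hx0]; field_simp
  have b3 : n * (g0 - k * x0) + 2 * k * π = n * g0 := by
    linear_combination -k * hnx
  have b4 : 3 * c ^ 2 * (((edges V).card : ℝ) * (g0 - k * x0) +
      2 * k * ∑ e ∈ edges V, volume.real (cone e.1 e.2 ∩ Metric.ball 0 1)) ≤ c := by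
    calc _ ≤ 3 * c ^ 2 * (n * g0) := by
          apply mul_le_mul_of_nonneg_left _ (by positivity)
          linarith
      _ = c := by linear_combination c * hcg
  linarith

/-- the linear functional `dt x` -/
noncomputable def dtL (x : E2) : E2 →L[ℝ] ℝ := LinearMap.toContinuousLinearMap
  (IsLinearMap.mk' (fun y => dt x y) ⟨fun a b => dt_add_right a b x, fun r a => dt_smul_right r a x⟩)

@[simp] lemma dtL_apply (x y : E2) : dtL x y = dt x y := rfl

lemma good_of_centroid (V0 : Finset E2) (P : Set E2) (hP : P = convexHull ℝ (V0 : Set E2))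
    (h1 : volume P = 1) (h0 : ∫ x in P, x = 0) : ∃ V, Good V P ∧ V.card ≤ V0.card := by
  classical
  have hcomp : IsCompact P := by rw [hP]; exact V0.finite_toSet.isCompact_convexHull ℝ
  have hconv : Convex ℝ P := by rw [hP]; exact convex_convexHull ℝ _
  have hIntg : IntegrableOn (fun x : E2 => x) P :=
    continuous_id.continuousOn.integrableOn_compact hcomp
  let V := V0.filter (fun v => v ∈ P.extremePoints ℝ)
  have hV : (V : Set E2) = P.extremePoints ℝ := by
    ext v
    simp only [V, Finset.coe_filter, mem_ofPred_eq, and_iff_right_iff_imp]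
    intro hv
    rw [hP] at hv
    exact extremePoints_convexHull_subset hv
  have hPV : P = convexHull ℝ (V : Set E2) := by
    have := closure_convexHull_extremePoints hcomp hconv
    rw [← hV, (V.finite_toSet.isClosed_convexHull ℝ).closure_eq] at this
    exact this.symm
  refine ⟨V, ⟨hPV, ?_, ?_, ?_⟩, Finset.card_filter_le _ _⟩
  · intro v hv; simp only [V, Finset.mem_filter] at hv; exact hv.2
  · intro x hx
    by_contra hc
    push Not at hc
    have hle : ∀ y ∈ P, dt x y ≤ 0 := by
      intro y hy
      rw [hPV] at hy
      have : convexHull ℝ (V : Set E2) ⊆ {y | dt x y ≤ 0} := by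
        apply convexHull_min
        · intro v hv; exact hc v hv
        · exact convex_halfSpace_le ⟨fun a b => dt_add_right a b x,
            fun r a => dt_smul_right r a x⟩ _
      exact this hy
    have hz : ∫ y in P, dt x y = 0 := by
      have := (dtL x).integral_comp_comm hIntg
      rw [h0, map_zero] at this
      exact this
    have hz' : ∫ y in P, -dt x y = 0 := by rw [integral_neg, hz, neg_zero]
    have hi' : IntegrableOn (fun y => -dt x y) P :=
      (dt_cont_right x).neg.continuousOn.integrableOn_compact hcomp
    rw [setIntegral_eq_zero_iff_of_nonneg_ae _ hi'] at hz'
    · have hnull : volume {y : E2 | dt x y = 0} = 0 := by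
        have := line_null x hx
        have e : {y : E2 | dt x y = 0} = {y : E2 | dt y x = 0} := by
          ext y; simp only [mem_ofPred_eq]; rw [dt_swap]; simp
        rw [e]; exact this
      have : ∀ᵐ y ∂(volume.restrict P), dt x y ≠ 0 :=
        ae_restrict_of_ae (by rw [ae_iff]; simpa using hnull)
      have hf : ∀ᵐ y ∂(volume.restrict P), False := by
        filter_upwards [this, hz'] with y a b
        apply a
        simpa using b
      rw [ae_iff] at hf
      simp [h1] at hf
    · filter_upwards [ae_restrict_mem hcomp.measurableSet] with y hy
      simp [hle y hy]
  · have : IsProbabilityMeasure (volume.restrict P) := ⟨by simp [h1]⟩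
    rw [← h0]
    exact hconv.integral_mem hcomp.isClosed (ae_restrict_mem hcomp.measurableSet) hIntg

lemma lower (n : ℕ) (hn : 3 ≤ n) (V0 : Finset E2) (hV0 : V0.card = n) (P : Set E2)
    (hP : P = convexHull ℝ (V0 : Set E2)) (h1 : volume P = 1) (ξ : E2) :
    cFun n ≤ ∫ x in P, ‖x - ξ‖ ^ 2 := by
  classical
  have hcomp : IsCompact P := by rw [hP]; exact V0.finite_toSet.isCompact_convexHull ℝ
  have hIntg : IntegrableOn (fun x : E2 => x) P :=
    continuous_id.continuousOn.integrableOn_compact hcomp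
  have : IsProbabilityMeasure (volume.restrict P) := ⟨by simp [h1]⟩
  set m : E2 := ∫ x in P, x with hm
  have hmp : MeasurePreserving (fun x : E2 => x - m) := measurePreserving_sub_right volume m
  have hemb : MeasurableEmbedding (fun x : E2 => x - m) := measurableEmbedding_subRight m
  set P' := (fun x : E2 => x - m) '' P with hP'
  have hhull : P' = convexHull ℝ ((V0.image (fun x => x - m) : Finset E2) : Set E2) := by
    rw [hP', hP, Finset.coe_image]
    have := (AffineEquiv.constVAdd ℝ E2 (-m)).toAffineMap.image_convexHull (V0 : Set E2)
    convert this using 1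
    · congr 1; ext x; simp [sub_eq_neg_add]
    · congr 2; ext x; simp [sub_eq_neg_add]
  have hvol : volume P' = 1 := by
    have := hmp.measure_preimage_emb hemb P'
    rw [← this, hP', preimage_image_eq _ hemb.injective, h1]
  have hcent : ∫ x in P', x = 0 := by
    rw [hP', hmp.setIntegral_image_emb hemb, integral_sub hIntg (integrable_const _)]
    simp [hm]
  obtain ⟨V, G, hV⟩ := good_of_centroid _ P' hhull hvol hcent
  have hlow := G.lower n hn (hV.trans (Finset.card_image_le.trans hV0.le)) (by simp [Measure.real, hvol])
  rw [hP', hmp.setIntegral_image_emb hemb] at hlow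
  have hic : ∀ f : E2 → ℝ, Continuous f → IntegrableOn f P :=
    fun f hf => hf.continuousOn.integrableOn_compact hcomp
  have hcross : ∫ x in P, inner ℝ (m - ξ) (x - m) = 0 := by
    rw [integral_inner (f := fun x => x - m) (hIntg.sub (integrable_const _)), integral_sub hIntg (integrable_const _)]
    simp [hm]
  have : ∫ x in P, ‖x - ξ‖ ^ 2 = ∫ x in P, (‖x - m‖ ^ 2 + 2 * inner ℝ (m - ξ) (x - m)
      + ‖m - ξ‖ ^ 2) := by
    congr 1; ext x
    have e : x - ξ = (x - m) + (m - ξ) := by abel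
    rw [e, norm_add_sq_real, real_inner_comm]
  rw [this, integral_add, integral_add, integral_const_mul, hcross]
  · simp only [integral_const, probReal_univ, one_smul]
    nlinarith [sq_nonneg ‖m - ξ‖]
  · exact hic _ (by fun_prop)
  · exact hic _ (by fun_prop)
  · exact hic _ (by fun_prop)
  · exact hic _ (by fun_prop)

lemma rv_zero (n : ℕ) (r : ℝ) (k : ℕ) : regularVertex n 0 r 0 k 0 = r * cos (2 * π * k / n) := by
  simp [regularVertex]
lemma rv_one (n : ℕ) (r : ℝ) (k : ℕ) : regularVertex n 0 r 0 k 1 = r * sin (2 * π * k / n) := by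
  simp [regularVertex]

lemma rv_dt (n : ℕ) (r : ℝ) (j k : ℕ) : dt (regularVertex n 0 r 0 j) (regularVertex n 0 r 0 k) =
    r ^ 2 * sin (((k : ℝ) - j) * (2 * π / n)) := by
  have : ((k : ℝ) - j) * (2 * π / n) = 2 * π * k / n - 2 * π * j / n := by ring
  rw [dt, rv_zero, rv_one, rv_zero, rv_one, this, sin_sub]; ring

lemma rv_inner (n : ℕ) (r : ℝ) (j k : ℕ) :
    regularVertex n 0 r 0 j 0 * regularVertex n 0 r 0 k 0 +
    regularVertex n 0 r 0 j 1 * regularVertex n 0 r 0 k 1 =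
    r ^ 2 * cos (((k : ℝ) - j) * (2 * π / n)) := by
  have : ((k : ℝ) - j) * (2 * π / n) = 2 * π * k / n - 2 * π * j / n := by ring
  rw [rv_zero, rv_one, rv_zero, rv_one, this, cos_sub]; ring

lemma rv_normsq (n : ℕ) (r : ℝ) (k : ℕ) : ‖regularVertex n 0 r 0 k‖ ^ 2 = r ^ 2 := by
  rw [normsq, rv_zero, rv_one]; linear_combination r ^ 2 * sin_sq_add_cos_sq (2 * π * k / n)

lemma rv_norm (n : ℕ) (r : ℝ) (hr : 0 < r) (k : ℕ) : ‖regularVertex n 0 r 0 k‖ = r :=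
  (pow_left_inj₀ (norm_nonneg _) hr.le (by norm_num)).1 (rv_normsq n r k)

lemma rv_n (n : ℕ) (hn : 3 ≤ n) (r : ℝ) : regularVertex n 0 r 0 n = regularVertex n 0 r 0 0 := by
  have : (n : ℝ) ≠ 0 := by positivity
  apply ext2
  · rw [rv_zero, rv_zero, mul_div_assoc, div_self this]; simp
  · rw [rv_one, rv_one, mul_div_assoc, div_self this]; simp

lemma rv_inj (n : ℕ) (hn : 3 ≤ n) (r : ℝ) (hr : 0 < r) :
    Function.Injective (fun k : Fin n => regularVertex n 0 r 0 k) := by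
  intro j k h
  simp only at h
  have hn0 : (0:ℝ) < n := by positivity
  have h1 := rv_inner n r j k
  rw [h, ← sq, ← sq, ← normsq, rv_normsq] at h1
  have h2 : cos (((k : ℝ) - j) * (2 * π / n)) = 1 := by
    have : r ^ 2 ≠ 0 := by positivity
    exact (mul_left_cancel₀ this (by linarith))
  have hj : ((j : ℕ) : ℝ) < n := by exact_mod_cast j.2
  have hk : ((k : ℕ) : ℝ) < n := by exact_mod_cast k.2
  have hj0 : (0:ℝ) ≤ ((j : ℕ) : ℝ) := by positivity
  have hk0 : (0:ℝ) ≤ ((k : ℕ) : ℝ) := by positivity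
  have hd : 0 < 2 * π / n := by positivity
  have hnd : n * (2 * π / n) = 2 * π := by field_simp
  rw [cos_eq_one_iff_of_lt_of_lt (by nlinarith) (by nlinarith)] at h2
  have h3 := (mul_eq_zero.1 h2).resolve_right hd.ne'
  ext
  have : ((k : ℕ) : ℝ) = ((j : ℕ) : ℝ) := by linarith
  exact_mod_cast this.symm

lemma rv_sum (n : ℕ) (hn : 3 ≤ n) (r : ℝ) : ∑ k : Fin n, regularVertex n 0 r 0 k = 0 := by
  have hn0 : (n : ℂ) ≠ 0 := by
    have : n ≠ 0 := by omega
    exact_mod_cast this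
  have h := (Complex.isPrimitiveRoot_exp n (by omega)).geom_sum_eq_zero (by omega)
  have e : ∀ k : ℕ, Complex.exp (2 * π * Complex.I / n) ^ k =
      (cos (2 * π * k / n) : ℂ) + (sin (2 * π * k / n) : ℂ) * Complex.I := by
    intro k
    rw [← Complex.exp_nat_mul]
    push_cast
    rw [← Complex.exp_mul_I]
    congr 1; ring
  simp_rw [e] at h
  have hre := congrArg Complex.re h
  have him := congrArg Complex.im h
  simp [-Complex.ofReal_cos, -Complex.ofReal_sin] at hre him
  rw [Finset.sum_range] at hre him
  apply ext2
  · simp only [WithLp.ofLp_sum, Finset.sum_apply, rv_zero, ← Finset.mul_sum, hre]; simp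
  · simp only [WithLp.ofLp_sum, Finset.sum_apply, rv_one, ← Finset.mul_sum, him]; simp

open Classical in
/-- vertices of the regular polygon -/
noncomputable def rvV (n : ℕ) (r : ℝ) : Finset E2 :=
  Finset.univ.image (fun k : Fin n => regularVertex n 0 r 0 k)

lemma rvV_coe (n : ℕ) (r : ℝ) :
    (rvV n r : Set E2) = Set.range (fun k : Fin n => regularVertex n 0 r 0 k) := by
  simp [rvV]

lemma rvV_card (n : ℕ) (hn : 3 ≤ n) (r : ℝ) (hr : 0 < r) : (rvV n r).card = n := by
  rw [rvV, Finset.card_image_of_injective _ (rv_inj n hn r hr)]; simp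

lemma mem_rvV (n : ℕ) (r : ℝ) (v : E2) : v ∈ rvV n r ↔ ∃ k < n, regularVertex n 0 r 0 k = v := by
  simp only [rvV, Finset.mem_image, Finset.mem_univ, true_and]
  constructor
  · rintro ⟨k, rfl⟩; exact ⟨k, k.2, rfl⟩
  · rintro ⟨k, hk, rfl⟩; exact ⟨⟨k, hk⟩, rfl⟩

lemma sin_delta (n : ℕ) (hn : 3 ≤ n) : 0 < sin (2 * π / n) := by
  have hn' : (3:ℝ) ≤ n := by exact_mod_cast hn
  have := pi_pos
  have hle : 2 * π / n ≤ 2 * π / 3 := by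
    apply div_le_div_of_nonneg_left (by positivity) (by norm_num) hn'
  exact sin_pos_of_pos_of_lt_pi (by positivity) (by linarith)

lemma rv_good (n : ℕ) (hn : 3 ≤ n) (r : ℝ) (hr : 0 < r) :
    Good (rvV n r) (convexHull ℝ (rvV n r : Set E2)) := by
  have hn0 : (0:ℝ) < n := by positivity
  have hmem : ∀ k : Fin n, regularVertex n 0 r 0 k ∈ rvV n r := fun k => by
    rw [mem_rvV]; exact ⟨k, k.2, rfl⟩
  refine ⟨rfl, ?_, ?_, ?_⟩
  · intro v hv
    have hsub : convexHull ℝ (rvV n r : Set E2) ⊆ Metric.closedBall 0 r := by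
      apply convexHull_min _ (convex_closedBall _ _)
      intro w hw
      obtain ⟨k, -, rfl⟩ := (mem_rvV n r w).1 hw
      simp [rv_norm n r hr]
    have hvn : ‖v‖ = r := by
      obtain ⟨k, -, rfl⟩ := (mem_rvV n r v).1 hv
      exact rv_norm n r hr k
    rw [mem_extremePoints]
    refine ⟨subset_convexHull ℝ _ hv, ?_⟩
    intro a ha b hb hab
    by_cases h : a = b
    · subst h
      rw [openSegment_same, mem_singleton_iff] at hab
      exact ⟨hab.symm, hab.symm⟩
    · exfalso
      have := (strictConvex_closedBall ℝ (0 : E2) r).openSegment_subset (hsub ha) (hsub hb) h hab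
      rw [interior_closedBall _ hr.ne', mem_ball_zero_iff] at this
      linarith
  · intro x hx
    by_contra hc
    push Not at hc
    have hs : ∑ k : Fin n, dt x (regularVertex n 0 r 0 k) = 0 := by
      have := congrArg (dtL x) (rv_sum n hn r)
      rw [map_sum, map_zero] at this
      exact this
    have hz := (Finset.sum_eq_zero_iff_of_nonpos (fun k _ => hc _ (hmem k))).1 hs
    have h0 := hz ⟨0, by omega⟩ (Finset.mem_univ _)
    have h1 := hz ⟨1, by omega⟩ (Finset.mem_univ _)
    simp only at h0 h1
    have hd : dt (regularVertex n 0 r 0 0) (regularVertex n 0 r 0 1) ≠ 0 := by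
      rw [rv_dt]
      have := sin_delta n hn
      simp only [Nat.cast_one, Nat.cast_zero, sub_zero, one_mul]
      positivity
    apply hx
    rw [decomp _ _ x hd, h1, dt_swap _ x, h0]; simp
  · have : (0 : E2) = ∑ k : Fin n, (1 / n : ℝ) • regularVertex n 0 r 0 k := by
      rw [← Finset.smul_sum, rv_sum n hn, smul_zero]
    rw [this]
    apply (convex_convexHull ℝ _).sum_mem
    · intro _ _; positivity
    · simp; field_simp
    · intro k _; exact subset_convexHull ℝ _ (hmem k)

lemma cos_bound {d y : ℝ} (hd : 0 ≤ d) (h1 : d ≤ y) (h2 : y ≤ 2 * π - d) : cos y ≤ cos d := by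
  rcases le_total y π with h | h
  · exact cos_le_cos_of_nonneg_of_le_pi hd h h1
  · rw [← cos_two_pi_sub y]
    exact cos_le_cos_of_nonneg_of_le_pi hd (by linarith) (by linarith)

lemma rv_edge (n : ℕ) (hn : 3 ≤ n) (r : ℝ) (hr : 0 < r) (k : ℕ) (hk : k < n) :
    (regularVertex n 0 r 0 k, regularVertex n 0 r 0 (k + 1)) ∈ edges (rvV n r) := by
  have hn0 : (0:ℝ) < n := by positivity
  have hn' : (3:ℝ) ≤ n := by exact_mod_cast hn
  have hsd := sin_delta n hn
  have hm1 : regularVertex n 0 r 0 (k + 1) ∈ rvV n r := by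
    rw [mem_rvV]
    rcases Nat.lt_or_ge (k + 1) n with h | h
    · exact ⟨k + 1, h, rfl⟩
    · have : k + 1 = n := by omega
      exact ⟨0, by omega, by rw [this, rv_n n hn]⟩
  have hdt : dt (regularVertex n 0 r 0 k) (regularVertex n 0 r 0 (k + 1)) =
      r ^ 2 * sin (2 * π / n) := by
    rw [rv_dt]; push_cast; congr 2; ring
  rw [mem_edges]
  refine ⟨(mem_rvV _ _ _).2 ⟨k, hk, rfl⟩, hm1, ?_, ?_⟩
  · simp only
    intro h
    rw [← h, dt_self] at hdt
    have : 0 < r ^ 2 * sin (2 * π / n) := by positivity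
    linarith
  · intro v hv
    obtain ⟨j, hj, rfl⟩ := (mem_rvV _ _ _).1 hv
    simp only
    rw [hdt, rv_dt, rv_dt, ← mul_add]
    apply mul_le_mul_of_nonneg_left _ (by positivity)
    push_cast
    set δ := 2 * π / n with hδ
    have hδ0 : 0 < δ := by positivity
    have hnδ : n * δ = 2 * π := by rw [hδ]; field_simp
    set y : ℝ := ((j : ℝ) - k - 1 / 2) * δ with hy
    have e1 : ((j : ℝ) - k) * δ = δ / 2 + y := by rw [hy]; ring
    have e2 : ((k : ℝ) + 1 - j) * δ = δ / 2 - y := by rw [hy]; ring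
    have e3 : δ = 2 * (δ / 2) := by ring
    have hδpi : δ ≤ π := by
      rw [hδ, div_le_iff₀ hn0]; nlinarith [pi_pos]
    have hs2 : 0 < sin (δ / 2) := sin_pos_of_pos_of_lt_pi (by positivity) (by linarith [pi_pos])
    have key : cos y ≤ cos (δ / 2) := by
      rcases Nat.lt_or_ge k j with h | h
      · have h' : (k : ℝ) + 1 ≤ j := by exact_mod_cast h
        have hj' : (j : ℝ) + 1 ≤ n := by exact_mod_cast hj
        have hk0 : (0 : ℝ) ≤ k := by positivity
        apply cos_bound (by positivity)
        · rw [hy]; nlinarith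
        · rw [hy, ← hnδ]; nlinarith
      · have h' : (j : ℝ) ≤ k := by exact_mod_cast h
        have hk' : (k : ℝ) + 1 ≤ n := by exact_mod_cast hk
        have hj0 : (0 : ℝ) ≤ j := by positivity
        rw [← cos_neg y]
        apply cos_bound (by positivity)
        · rw [hy]; nlinarith
        · rw [hy, ← hnδ]; nlinarith
    rw [e1, e2, sin_add, sin_sub]
    conv_rhs => rw [e3, sin_two_mul]
    nlinarith

lemma rv_edges (n : ℕ) (hn : 3 ≤ n) (r : ℝ) (hr : 0 < r) {e : E2 × E2}
    (he : e ∈ edges (rvV n r)) : ∃ k < n, e.1 = regularVertex n 0 r 0 k ∧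
      e.2 = regularVertex n 0 r 0 (k + 1) := by
  obtain ⟨u, w⟩ := e
  obtain ⟨k, hk, h⟩ := (mem_rvV _ _ _).1 (mem_edges.1 he).1
  refine ⟨k, hk, h.symm, ?_⟩
  simp only at h
  subst h
  exact (rv_good n hn r hr).edge_unique he (rv_edge n hn r hr k hk)

lemma rv_card_edges (n : ℕ) (hn : 3 ≤ n) (r : ℝ) (hr : 0 < r) : (edges (rvV n r)).card = n := by
  apply le_antisymm
  · exact ((rv_good n hn r hr).card_edges).trans (rvV_card n hn r hr).le
  · have : (Finset.univ : Finset (Fin n)).card ≤ (edges (rvV n r)).card := by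
      apply Finset.card_le_card_of_injOn
        (fun k : Fin n => (regularVertex n 0 r 0 k, regularVertex n 0 r 0 (k + 1)))
      · intro k _; exact rv_edge n hn r hr k k.2
      · intro j _ k _ h
        simp only [Prod.mk.injEq] at h
        exact rv_inj n hn r hr h.1
    simpa using this

lemma rv_edge_dt (n : ℕ) (hn : 3 ≤ n) (r : ℝ) (hr : 0 < r) {e : E2 × E2}
    (he : e ∈ edges (rvV n r)) : dt e.1 e.2 = r ^ 2 * sin (2 * π / n) ∧
      ‖e.1‖ ^ 2 = r ^ 2 ∧ ‖e.2‖ ^ 2 = r ^ 2 ∧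
      e.1 0 * e.2 0 + e.1 1 * e.2 1 = r ^ 2 * cos (2 * π / n) := by
  obtain ⟨k, hk, h1, h2⟩ := rv_edges n hn r hr he
  rw [h1, h2, rv_dt, rv_normsq, rv_normsq, rv_inner]
  push_cast
  refine ⟨?_, rfl, rfl, ?_⟩ <;> congr 2 <;> ring

lemma exists_regular (n : ℕ) (hn : 3 ≤ n) : ∃ r : ℝ, 0 < r ∧
    volume (convexHull ℝ (rvV n r : Set E2)) = 1 ∧
    ∫ x in convexHull ℝ (rvV n r : Set E2), ‖x‖ ^ 2 = cFun n := by
  have hn0 : (0:ℝ) < n := by positivity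
  have hs := sin_delta n hn
  set r := √(2 / (n * sin (2 * π / n))) with hrdef
  have hr : 0 < r := by positivity
  have hr2 : r ^ 2 = 2 / (n * sin (2 * π / n)) := sq_sqrt (by positivity)
  have G := rv_good n hn r hr
  refine ⟨r, hr, ?_, ?_⟩
  · have ha := G.area
    rw [Finset.sum_congr rfl (fun e he => by rw [(rv_edge_dt n hn r hr he).1]),
      Finset.sum_const, rv_card_edges n hn r hr, nsmul_eq_mul, hr2] at ha
    have : volume.real (convexHull ℝ (rvV n r : Set E2)) = 1 := by
      rw [ha]; field_simp
    exact (ENNReal.toReal_eq_one_iff _).1 this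
  · rw [G.moment, Finset.sum_congr rfl (fun e he => by
      obtain ⟨h1, h2, h3, h4⟩ := rv_edge_dt n hn r hr he
      rw [h1, h2, h3, h4]),
      Finset.sum_const, rv_card_edges n hn r hr, nsmul_eq_mul, hr2, cFun_eq n hn]
    field_simp
    ring

end MomentLemma

/-- Fejes Tóth's Moment Lemma: `c_n` is the minimum of the second moment
`∫_P |x - ξ|² dx` over convex `n`-gons `P` of unit area and points `ξ ∈ ℝ²`, and
the minimum is attained by a regular `n`-gon about its centre. -/
theorem stmt0 (n : ℕ) (hn : 3 ≤ n) :
    IsLeast { I : ℝ | ∃ P ξ, IsConvexNGon n P ∧ volume P = 1 ∧ I = secondMoment P ξ }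
      (cFun n) ∧
    ∃ P c, IsRegularNGon n P c ∧ volume P = 1 ∧ secondMoment P c = cFun n := by
  obtain ⟨r, hr, h1, h2⟩ := MomentLemma.exists_regular n hn
  have h3 : secondMoment (convexHull ℝ (MomentLemma.rvV n r : Set (EuclideanSpace ℝ (Fin 2)))) 0 =
      cFun n := by
    rw [secondMoment, ← h2]; simp only [sub_zero]
  refine ⟨⟨⟨_, 0, ⟨MomentLemma.rvV n r, MomentLemma.rvV_card n hn r hr, rfl⟩, h1, h3.symm⟩, ?_⟩,
    _, 0, ⟨r, 0, hr, ?_⟩, h1, h3⟩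
  · rintro I ⟨P, ξ, ⟨V, hV, hP⟩, hvol, rfl⟩
    exact MomentLemma.lower n hn V hV P hP hvol ξ
  · rw [MomentLemma.rvV_coe]
end

section
/- For any convex n-gon P of area m > 0 and any point ξ ∈ ℝ², the second moment satisfies ∫_P |x − ξ|² dx ≥ c_n · m², where c_n = (1/(2n)) ((1/3) tan(π/n) + cot(π/n)). -/
open Real MeasureTheory Set

lemma split_ineq (φ : ℝ → ℝ) (κ α a : ℝ) (Θ : Finset ℝ) :
    ∀ b, a < b → (∀ θ ∈ Θ, θ ∈ Ioo a b) →
    (∀ c d, c < d → a ≤ c → d ≤ b → (∀ θ ∈ Θ, θ ∉ Ioo c d) →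
      IntervalIntegrable φ volume c d ∧ κ + α * (d - c) ≤ ∫ x in c..d, φ x) →
    IntervalIntegrable φ volume a b ∧
      (Θ.card + 1) * κ + α * (b - a) ≤ ∫ x in a..b, φ x := by
  induction Θ using Finset.induction_on_max with
  | empty =>
    intro b hab _ h
    have := h a b hab le_rfl le_rfl (by simp)
    simpa using this
  | insert x s hx ih =>
    intro b hab hs h
    have hxab := hs x (Finset.mem_insert_self _ _)
    have hxs : x ∉ s := fun hh => lt_irrefl _ (hx x hh)
    obtain ⟨i1, l1⟩ := ih x hxab.1
      (fun θ hθ => ⟨(hs θ (Finset.mem_insert_of_mem hθ)).1, hx θ hθ⟩)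
      (fun c d hcd hac hdx hno => h c d hcd hac (hdx.trans hxab.2.le) (by
        intro θ hθ
        rcases Finset.mem_insert.1 hθ with rfl | h'
        · intro hh; exact absurd hh.2 (not_lt.2 hdx)
        · exact hno θ h'))
    obtain ⟨i2, l2⟩ := h x b hxab.2 hxab.1.le le_rfl (by
        intro θ hθ hh
        rcases Finset.mem_insert.1 hθ with rfl | h'
        · exact lt_irrefl _ hh.1
        · exact lt_asymm (hx θ h') hh.1)
    refine ⟨i1.trans i2, ?_⟩
    rw [← intervalIntegral.integral_add_adjacent_intervals i1 i2,
      Finset.card_insert_of_notMem hxs]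
    push_cast
    linarith

/-- concavity tangent-line inequality -/
lemma hasDerivAt_H (u : ℝ) : HasDerivAt (fun u => sin u / (2 + cos u))
    ((2 * cos u + 1) / (2 + cos u) ^ 2) u := by
  have h2 : 2 + cos u ≠ 0 := by linarith [neg_one_le_cos u]
  have := (hasDerivAt_sin u).div ((hasDerivAt_cos u).const_add 2) h2
  refine this.congr_deriv ?_
  congr 1
  nlinarith [sin_sq_add_cos_sq u]

lemma H_concave : ConcaveOn ℝ (Icc 0 π) (fun u => sin u / (2 + cos u)) := by
  apply AntitoneOn.concaveOn_of_deriv (convex_Icc _ _)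
  · exact fun x _ => (hasDerivAt_H x).continuousAt.continuousWithinAt
  · exact fun x _ => (hasDerivAt_H x).differentiableAt.differentiableWithinAt
  · rw [interior_Icc]
    intro x hx y hy hxy
    rw [(hasDerivAt_H x).deriv, (hasDerivAt_H y).deriv]
    have hc : cos y ≤ cos x := cos_le_cos_of_nonneg_of_le_pi hx.1.le hy.2.le hxy
    have h1 := neg_one_le_cos y
    have h2 := cos_le_one x
    rw [div_le_div_iff₀ (by nlinarith) (by nlinarith)]
    have e : (2 * cos x + 1) * (2 + cos y) ^ 2 - (2 * cos y + 1) * (2 + cos x) ^ 2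
      = (cos x - cos y) * (4 - 2 * cos x * cos y - cos x - cos y) := by ring
    have : 0 ≤ 4 - 2 * cos x * cos y - cos x - cos y := by
      nlinarith [neg_one_le_cos x, cos_le_one y]
    nlinarith [mul_nonneg (sub_nonneg.2 hc) this]

lemma H_tangent (u v : ℝ) (hu : u ∈ Ioo 0 π) (hv : v ∈ Icc 0 π) :
    sin v / (2 + cos v) ≤ sin u / (2 + cos u) + (2 * cos u + 1) / (2 + cos u) ^ 2 * (v - u) := by
  have hu' : u ∈ Icc 0 π := ⟨hu.1.le, hu.2.le⟩
  rcases lt_trichotomy u v with h | h | h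
  · have := H_concave.slope_le_of_hasDerivAt hu' hv h (hasDerivAt_H u)
    rw [slope_def_field, div_le_iff₀ (by linarith)] at this
    linarith
  · subst h; simp
  · have := H_concave.le_slope_of_hasDerivAt hv hu' h (hasDerivAt_H u)
    rw [slope_def_field, le_div_iff₀ (by linarith)] at this
    linarith

lemma arc_ineq (p q u l : ℝ) (hp : 0 < p) (hq : 0 < q) (hs : 0 ≤ sin u) :
    - (3 * l ^ 2 * (sin u / (2 + cos u))) ≤
      p * q * sin u * ((p ^ 2 + q ^ 2 + p * q * cos u) / 12 - l) := by
  have h2 : 0 < 2 + cos u := by linarith [neg_one_le_cos u]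
  have e : p * q * sin u * ((p ^ 2 + q ^ 2 + p * q * cos u) / 12 - l)
     + (3 * l ^ 2 * (sin u / (2 + cos u))) = p * q * sin u * ((p - q) ^ 2 / 12) +
      sin u / (12 * (2 + cos u)) * (p * q * (2 + cos u) - 6 * l) ^ 2 := by
    field_simp; ring
  have : 0 ≤ p * q * sin u * ((p - q) ^ 2 / 12) +
      sin u / (12 * (2 + cos u)) * (p * q * (2 + cos u) - 6 * l) ^ 2 := by positivity
  linarith

/-- the reciprocal radial function of the side from `p e^{ic}` to `q e^{id}` -/
noncomputable def Nf (p q c d θ : ℝ) : ℝ :=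
  (q * sin (d - θ) + p * sin (θ - c)) / (p * q * sin (d - c))

lemma Nf_pos (p q c d θ : ℝ) (hp : 0 < p) (hq : 0 < q) (hcd : c < d) (hd : d - c < π)
    (h : θ ∈ Icc c d) : 0 < q * sin (d - θ) + p * sin (θ - c) := by
  have h1 : 0 ≤ sin (d - θ) := sin_nonneg_of_nonneg_of_le_pi (by linarith [h.2]) (by linarith [h.1])
  have h2 : 0 ≤ sin (θ - c) := sin_nonneg_of_nonneg_of_le_pi (by linarith [h.1]) (by linarith [h.2])
  rcases eq_or_lt_of_le h.1 with h' | h'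
  · have : 0 < sin (d - θ) := sin_pos_of_pos_of_lt_pi (by linarith) (by linarith)
    positivity
  · have : 0 < sin (θ - c) := sin_pos_of_pos_of_lt_pi (by linarith) (by linarith [h.2])
    positivity

lemma arc_integral (p q c d l : ℝ) (hp : 0 < p) (hq : 0 < q) (hcd : c < d) (hd : d - c < π) :
    IntervalIntegrable (fun θ => 1 / (4 * Nf p q c d θ ^ 4) - l / Nf p q c d θ ^ 2) volume c d ∧
    ∫ θ in c..d, (1 / (4 * Nf p q c d θ ^ 4) - l / Nf p q c d θ ^ 2) =
      p * q * sin (d - c) * ((p ^ 2 + q ^ 2 + p * q * cos (d - c)) / 12 - l) := by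
  have hsu : 0 < sin (d - c) := sin_pos_of_pos_of_lt_pi (by linarith) hd
  have hD := fun θ (h : θ ∈ Icc c d) => Nf_pos p q c d θ hp hq hcd hd h
  have hint : IntervalIntegrable (fun θ => 1 / (4 * Nf p q c d θ ^ 4) - l / Nf p q c d θ ^ 2)
      volume c d := by
    apply ContinuousOn.intervalIntegrable
    rw [uIcc_of_le hcd.le]
    have hc : ContinuousOn (fun θ => Nf p q c d θ) (Icc c d) := by
      unfold Nf; fun_prop
    have hn : ∀ θ ∈ Icc c d, Nf p q c d θ ≠ 0 := fun θ h => by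
      have := hD θ h
      unfold Nf; positivity
    refine ContinuousOn.sub (ContinuousOn.div continuousOn_const (by fun_prop) ?_)
      (ContinuousOn.div continuousOn_const (by fun_prop) ?_)
    · intro x hx; have := hn x hx; positivity
    · intro x hx; have := hn x hx; positivity
  refine ⟨hint, ?_⟩
  let t : ℝ → ℝ := fun θ => p * sin (θ - c) / (q * sin (d - θ) + p * sin (θ - c))
  let F : ℝ → ℝ := fun θ => p * q * sin (d - c) * ((1/4) * (p^2 * t θ + (t θ)^2 * (p * q * cos (d-c) - p^2)
    + (t θ)^3 / 3 * (p^2 + q^2 - 2 * p * q * cos (d-c))) - l * t θ)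
  have hF : ∀ θ ∈ uIcc c d, HasDerivAt F (1 / (4 * Nf p q c d θ ^ 4) - l / Nf p q c d θ ^ 2) θ := by
    intro θ hθ
    rw [uIcc_of_le hcd.le] at hθ
    have hDθ := hD θ hθ
    set D := q * sin (d - θ) + p * sin (θ - c) with hDdef
    have ht : HasDerivAt t (p * q * sin (d - c) / D ^ 2) θ := by
      have h1 : HasDerivAt (fun θ => sin (θ - c)) (cos (θ - c)) θ := by
        simpa using ((hasDerivAt_id θ).sub_const c).sin
      have h2 : HasDerivAt (fun θ => sin (d - θ)) (-cos (d - θ)) θ := by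
        simpa using ((hasDerivAt_id θ).const_sub d).sin
      have := (h1.const_mul p).div ((h2.const_mul q).add (h1.const_mul p)) hDθ.ne'
      refine HasDerivAt.congr_deriv this ?_
      have e : sin (d - c) = sin (d - θ) * cos (θ - c) + cos (d - θ) * sin (θ - c) := by
        rw [← sin_add]; congr 1; ring
      rw [e]; congr 1; simp only [Pi.add_apply]; ring
    have hQ : p^2 + 2 * t θ * (p * q * cos (d-c) - p^2) + (t θ)^2 * (p^2 + q^2 - 2 * p * q * cos (d-c))
        = (p * q * sin (d - c)) ^ 2 / D ^ 2 := by
      have e1 : sin (d - c) = sin (d - θ) * cos (θ - c) + cos (d - θ) * sin (θ - c) := by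
        rw [← sin_add]; congr 1; ring
      have e2 : cos (d - c) = cos (d - θ) * cos (θ - c) - sin (d - θ) * sin (θ - c) := by
        rw [← cos_add]; congr 1; ring
      have ht : t θ = p * sin (θ - c) / D := rfl
      rw [ht]
      field_simp
      rw [e1, e2, hDdef]
      have s1 := sin_sq_add_cos_sq (d - θ)
      have s2 := sin_sq_add_cos_sq (θ - c)
      generalize sin (d - θ) = x at *
      generalize cos (d - θ) = y at *
      generalize sin (θ - c) = z at *
      generalize cos (θ - c) = w at *
      have hy : y ^ 2 = 1 - x ^ 2 := by linarith
      have hw : w ^ 2 = 1 - z ^ 2 := by linarith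
      ring_nf
      simp only [hy, hw]
      ring
    have := (((((ht.const_mul (p^2)).add ((ht.pow 2).mul_const (p * q * cos (d-c) - p^2))).add
      (((ht.pow 3).div_const 3).mul_const (p^2 + q^2 - 2 * p * q * cos (d-c)))).const_mul (1/4)).sub
      (ht.const_mul l)).const_mul (p * q * sin (d - c))
    refine HasDerivAt.congr_deriv this ?_
    have hN : Nf p q c d θ = D / (p * q * sin (d - c)) := rfl
    rw [hN]
    set S := p * q * sin (d - c) with hS
    have hS0 : 0 < S := by positivity
    have : S * (1 / 4 * (p ^ 2 * (S / D ^ 2) + ((2:ℕ) * t θ ^ (2 - 1) * (S / D ^ 2)) * (p * q * cos (d - c) - p ^ 2)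
       + (((3:ℕ) * t θ ^ (3 - 1) * (S / D ^ 2)) / 3) * (p ^ 2 + q ^ 2 - 2 * p * q * cos (d - c))) - l * (S / D ^ 2))
       = S * (S / D ^ 2) * ((1/4) * (p^2 + 2 * t θ * (p * q * cos (d-c) - p^2) + (t θ)^2 * (p^2 + q^2 - 2 * p * q * cos (d-c))) - l) := by
      norm_num; ring
    rw [this, hQ]
    field_simp
  rw [intervalIntegral.integral_eq_sub_of_hasDerivAt hF hint]
  have tc : t c = 0 := by simp [t]
  have td : t d = 1 := by
    simp only [t, sub_self, sin_zero, mul_zero, zero_add]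
    exact div_self (by positivity)
  simp only [F, tc, td]
  ring
noncomputable def pt (r θ : ℝ) : ℂ := ⟨r * cos θ, r * sin θ⟩

@[simp] lemma pt_re (r θ : ℝ) : (pt r θ).re = r * cos θ := rfl
@[simp] lemma pt_im (r θ : ℝ) : (pt r θ).im = r * sin θ := rfl

lemma norm_pt_sq (r θ : ℝ) : ‖pt r θ‖ ^ 2 = r ^ 2 := by
  rw [Complex.sq_norm, Complex.normSq_apply]
  simp only [pt_re, pt_im]
  linear_combination r ^ 2 * sin_sq_add_cos_sq θ

lemma continuous_pt : Continuous (fun x : ℝ × ℝ => pt x.1 x.2) := by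
  have : (fun x : ℝ × ℝ => pt x.1 x.2) =
      fun x : ℝ × ℝ => ((x.1 * cos x.2 : ℝ) : ℂ) + ((x.1 * sin x.2 : ℝ) : ℂ) * Complex.I := by
    funext x
    apply Complex.ext <;> simp [-Complex.ofReal_cos, -Complex.ofReal_sin]
  rw [this]
  fun_prop

lemma exists_radius (P : Set ℂ) (hc : IsCompact P) (h0 : (0:ℂ) ∈ interior P) (θ : ℝ) :
    ∃ R, 0 < R ∧ pt R θ ∈ P ∧ ∀ t, pt t θ ∈ P → t ≤ R := by
  have hcont : Continuous (fun r => pt r θ) := continuous_pt.comp (by fun_prop : Continuous fun r : ℝ => (r, θ))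
  obtain ⟨B, hB⟩ := hc.isBounded.exists_norm_le
  have hcl : IsClosed ((fun r => pt r θ) ⁻¹' P) := hc.isClosed.preimage hcont
  have hbd : ∀ t ∈ (fun r => pt r θ) ⁻¹' P, |t| ≤ B := by
    intro t ht
    have h1 := hB _ ht
    have h2 := norm_pt_sq t θ
    have : ‖pt t θ‖ = |t| := by
      rw [← abs_of_nonneg (norm_nonneg (pt t θ)), ← sq_eq_sq_iff_abs_eq_abs]; exact h2
    linarith
  have hK : IsCompact ((fun r => pt r θ) ⁻¹' P) := by
    apply (isCompact_Icc (a := -B) (b := B)).of_isClosed_subset hcl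
    intro t ht
    exact abs_le.1 (hbd t ht)
  have p0 : pt 0 θ = 0 := by apply Complex.ext <;> simp
  have hnh : (fun r => pt r θ) ⁻¹' P ∈ nhds (0:ℝ) := by
    apply hcont.continuousAt.preimage_mem_nhds
    rw [p0]; exact mem_interior_iff_mem_nhds.1 h0
  obtain ⟨R, hR1, hR2⟩ := hK.exists_isGreatest ⟨0, mem_of_mem_nhds hnh⟩
  refine ⟨R, ?_, hR1, fun t ht => hR2 ht⟩
  obtain ⟨ε, hε, hball⟩ := Metric.mem_nhds_iff.1 hnh
  have : ε / 2 ∈ (fun r => pt r θ) ⁻¹' P := hball (by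
    rw [Metric.mem_ball, Real.dist_eq, sub_zero, abs_of_pos (by linarith)]; linarith)
  have := hR2 this
  linarith

lemma exists_angle (z : ℂ) (c : ℝ) (h : 0 < z.im * cos c - z.re * sin c) :
    ∃ r α, 0 < r ∧ 0 < α ∧ α < π ∧ z = pt r (c + α) := by
  let w : ℂ := ⟨z.re * cos c + z.im * sin c, z.im * cos c - z.re * sin c⟩
  have e1 := Complex.norm_mul_cos_arg w
  have e2 := Complex.norm_mul_sin_arg w
  have hw : 0 < w.im := h
  have hw0 : w ≠ 0 := by intro hh; rw [hh] at hw; simp at hw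
  have hn : 0 < ‖w‖ := norm_pos_iff.2 hw0
  have hs : 0 < sin w.arg := by
    by_contra hh
    nlinarith [not_lt.1 hh]
  have ha : 0 ≤ w.arg := Complex.arg_nonneg_iff.2 hw.le
  refine ⟨‖w‖, w.arg, hn, ?_, ?_, ?_⟩
  · rcases ha.lt_or_eq with h' | h'
    · exact h'
    · rw [← h'] at hs; simp at hs
  · rcases (Complex.arg_le_pi w).lt_or_eq with h' | h'
    · exact h'
    · rw [h'] at hs; simp at hs
  · have f1 : w.re = z.re * cos c + z.im * sin c := rfl
    have f2 : w.im = z.im * cos c - z.re * sin c := rfl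
    apply Complex.ext
    · simp only [pt_re, cos_add]
      rw [f1] at e1; rw [f2] at e2
      linear_combination (-cos c) * e1 + sin c * e2 - z.re * sin_sq_add_cos_sq c
    · simp only [pt_im, sin_add]
      rw [f1] at e1; rw [f2] at e2
      linear_combination (-sin c) * e1 - cos c * e2 - z.im * sin_sq_add_cos_sq c

lemma isLinear_comb (a b : ℝ) : IsLinearMap ℝ (fun z : ℂ => a * z.re + b * z.im) :=
  ⟨fun x y => by simp; ring, fun x y => by simp; ring⟩

lemma gap_lt_pi (V : Set ℂ) (h0 : (0:ℂ) ∈ interior (convexHull ℝ V)) (c d : ℝ)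
    (hno : ∀ v ∈ V, ∀ θ ∈ Ioo c d, ∀ r, 0 < r → v ≠ pt r θ) : d - c < π := by
  by_contra hge
  push Not at hge
  have hV : V ⊆ {z : ℂ | (-sin c) * z.re + cos c * z.im ≤ 0} := by
    intro v hv
    by_contra hh
    simp only [mem_ofPred_eq, not_le] at hh
    obtain ⟨r, α, hr, h1, h2, h3⟩ := exists_angle v c (by linarith)
    exact hno v hv (c + α) ⟨by linarith, by linarith⟩ r hr h3
  have hP := convexHull_min hV (convex_halfSpace_le (isLinear_comb _ _) 0)
  have hcont : Continuous (fun r => pt r (c + π / 2)) :=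
    continuous_pt.comp (by fun_prop : Continuous fun r : ℝ => (r, c + π / 2))
  have p0 : pt 0 (c + π / 2) = 0 := by apply Complex.ext <;> simp
  have hnh : (fun r => pt r (c + π / 2)) ⁻¹' (convexHull ℝ V) ∈ nhds (0:ℝ) := by
    apply hcont.continuousAt.preimage_mem_nhds
    rw [p0]; exact mem_interior_iff_mem_nhds.1 h0
  obtain ⟨ε, hε, hball⟩ := Metric.mem_nhds_iff.1 hnh
  have : ε / 2 ∈ (fun r => pt r (c + π / 2)) ⁻¹' (convexHull ℝ V) := hball (by
    rw [Metric.mem_ball, Real.dist_eq, sub_zero, abs_of_pos (by linarith)]; linarith)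
  have := hP this
  simp only [mem_ofPred_eq, pt_re, pt_im, cos_add_pi_div_two, sin_add_pi_div_two] at this
  nlinarith [sin_sq_add_cos_sq c]

lemma sector_mem (V : Set ℂ) (h0 : (0:ℂ) ∈ convexHull ℝ V) (c d p q : ℝ)
    (hcd : c < d) (hd : d - c < π) (hp : 0 < p) (hq : 0 < q)
    (hno : ∀ v ∈ V, ∀ θ ∈ Ioo c d, ∀ r, 0 < r → v ≠ pt r θ)
    (hpP : pt p c ∈ convexHull ℝ V) (hpm : ∀ t, pt t c ∈ convexHull ℝ V → t ≤ p)
    (hqP : pt q d ∈ convexHull ℝ V) (hqm : ∀ t, pt t d ∈ convexHull ℝ V → t ≤ q)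
    (θ : ℝ) (hθ : θ ∈ Ioo c d) (r : ℝ) (hr : 0 < r) :
    pt r θ ∈ convexHull ℝ V ↔ r * Nf p q c d θ ≤ 1 := by
  have hsu : 0 < sin (d - c) := sin_pos_of_pos_of_lt_pi (by linarith) hd
  have esu : sin (d - c) = sin d * cos c - cos d * sin c := sin_sub d c
  have hconv : Convex ℝ (convexHull ℝ V) := convex_convexHull ℝ V
  have hs1 : 0 < sin (d - θ) := sin_pos_of_pos_of_lt_pi (by linarith [hθ.2]) (by linarith [hθ.1])
  have hs2 : 0 < sin (θ - c) := sin_pos_of_pos_of_lt_pi (by linarith [hθ.1]) (by linarith [hθ.2])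
  set S : ℂ → ℝ := fun z => z.re * sin d - z.im * cos d with hS
  set T : ℂ → ℝ := fun z => z.im * cos c - z.re * sin c with hT
  have hSx : S (pt r θ) = r * sin (d - θ) := by simp only [hS, pt_re, pt_im, sin_sub]; ring
  have hTx : T (pt r θ) = r * sin (θ - c) := by simp only [hT, pt_re, pt_im, sin_sub]; ring
  have hdec : ∀ z : ℂ, z = (S z / sin (d - c)) • pt 1 c + (T z / sin (d - c)) • pt 1 d := by
    intro z
    apply Complex.ext
    · simp only [Complex.add_re, Complex.smul_re, pt_re, smul_eq_mul, one_mul, hS, hT]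
      field_simp
      rw [esu]; ring
    · simp only [Complex.add_im, Complex.smul_im, pt_im, smul_eq_mul, one_mul, hS, hT]
      field_simp
      rw [esu]; ring
  have hsm : ∀ t s α : ℝ, t • pt s α = pt (t * s) α := by
    intro t s α
    apply Complex.ext <;> simp <;> ring
  have hN : r * Nf p q c d θ ≤ 1 ↔
      q * S (pt r θ) + p * T (pt r θ) ≤ p * q * sin (d - c) := by
    rw [hSx, hTx, Nf, ← mul_div_assoc, div_le_one (by positivity)]
    constructor <;> intro h <;> linarith
  rw [hN]
  constructor
  · intro hx
    by_contra hgt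
    push Not at hgt
    have hSxp : 0 < S (pt r θ) := by rw [hSx]; positivity
    have hTxp : 0 < T (pt r θ) := by rw [hTx]; positivity
    generalize pt r θ = x at *
    have hv : ∃ v ∈ V, p * q * sin (d - c) < q * S v + p * T v := by
      by_contra hall
      push Not at hall
      have hV : V ⊆ {z : ℂ | (q * sin d - p * sin c) * z.re + (p * cos c - q * cos d) * z.im
          ≤ p * q * sin (d - c)} := by
        intro v hv
        have := hall v hv
        simp only [hS, hT, mem_ofPred_eq] at this ⊢
        linarith
      have := convexHull_min hV (convex_halfSpace_le (isLinear_comb _ _) _) hx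
      simp only [hS, hT, mem_ofPred_eq] at this hgt
      linarith
    obtain ⟨v, hvV, hv⟩ := hv
    have hvP : v ∈ convexHull ℝ V := subset_convexHull ℝ V hvV
    rcases le_or_gt (S v) 0 with hSv | hSv
    · have hD : 0 < S x - S v := by linarith
      have hw := hconv hvP hx (a := S x / (S x - S v)) (b := -S v / (S x - S v))
        (by positivity) (div_nonneg (by linarith) hD.le) (by field_simp; ring)
      set w := (S x / (S x - S v)) • v + (-S v / (S x - S v)) • x with hwdef
      have hSw : S w = 0 := by
        have : S w = (S x / (S x - S v)) * S v + (-S v / (S x - S v)) * S x := by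
          simp only [hwdef, hS, Complex.add_re, Complex.smul_re, Complex.add_im, Complex.smul_im,
            smul_eq_mul]
          ring
        rw [this]; field_simp; ring
      have hTw : T w = (S x / (S x - S v)) * T v + (-S v / (S x - S v)) * T x := by
        simp only [hwdef, hT, Complex.add_re, Complex.smul_re, Complex.add_im, Complex.smul_im,
            smul_eq_mul]
        ring
      have hww := hdec w
      rw [hSw, zero_div, zero_smul, zero_add, hsm, mul_one] at hww
      rw [hww] at hw
      have := hqm _ hw
      rw [div_le_iff₀ hsu, hTw] at this
      have e : (S x / (S x - S v)) * T v + (-S v / (S x - S v)) * T x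
        = (S x * T v - S v * T x) / (S x - S v) := by ring
      rw [e, div_le_iff₀ hD] at this
      have := mul_le_mul_of_nonneg_left this hp.le
      nlinarith [mul_lt_mul_of_pos_left hv hSxp, mul_le_mul_of_nonneg_left hgt.le (neg_nonneg.2 hSv)]
    rcases le_or_gt (T v) 0 with hTv | hTv
    · have hD : 0 < T x - T v := by linarith
      have hw := hconv hvP hx (a := T x / (T x - T v)) (b := -T v / (T x - T v))
        (by positivity) (div_nonneg (by linarith) hD.le) (by field_simp; ring)
      set w := (T x / (T x - T v)) • v + (-T v / (T x - T v)) • x with hwdef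
      have hTw : T w = 0 := by
        have : T w = (T x / (T x - T v)) * T v + (-T v / (T x - T v)) * T x := by
          simp only [hwdef, hT, Complex.add_re, Complex.smul_re, Complex.add_im, Complex.smul_im,
            smul_eq_mul]
          ring
        rw [this]; field_simp; ring
      have hSw : S w = (T x / (T x - T v)) * S v + (-T v / (T x - T v)) * S x := by
        simp only [hwdef, hS, Complex.add_re, Complex.smul_re, Complex.add_im, Complex.smul_im,
            smul_eq_mul]
        ring
      have hww := hdec w
      rw [hTw, zero_div, zero_smul, add_zero, hsm, mul_one] at hww
      rw [hww] at hw
      have := hpm _ hw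
      rw [div_le_iff₀ hsu, hSw] at this
      have e : (T x / (T x - T v)) * S v + (-T v / (T x - T v)) * S x
        = (T x * S v - T v * S x) / (T x - T v) := by ring
      rw [e, div_le_iff₀ hD] at this
      have := mul_le_mul_of_nonneg_left this hq.le
      nlinarith [mul_lt_mul_of_pos_left hv hTxp, mul_le_mul_of_nonneg_left hgt.le (neg_nonneg.2 hTv)]
    obtain ⟨r', α, hr', h1, h2, h3⟩ := exists_angle v c hTv
    refine hno v hvV (c + α) ⟨by linarith, ?_⟩ r' hr' h3
    by_contra hge
    push Not at hge
    have e : S v = r' * sin (d - (c + α)) := by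
      rw [h3]; simp only [hS, pt_re, pt_im, sin_sub]; ring
    have : 0 ≤ sin (c + α - d) := sin_nonneg_of_nonneg_of_le_pi (by linarith) (by linarith)
    have e2 : sin (d - (c + α)) = - sin (c + α - d) := by rw [← sin_neg]; congr 1; ring
    rw [e, e2] at hSv
    nlinarith
  · intro h
    have hx := hdec (pt r θ)
    have e1 : pt 1 c = p⁻¹ • pt p c := by rw [hsm, inv_mul_cancel₀ hp.ne']
    have e2 : pt 1 d = q⁻¹ • pt q d := by rw [hsm, inv_mul_cancel₀ hq.ne']
    rw [e1, e2, smul_smul, smul_smul] at hx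
    rw [hx]
    have hSxp : 0 < S (pt r θ) := by rw [hSx]; positivity
    have hTxp : 0 < T (pt r θ) := by rw [hTx]; positivity
    set A := S (pt r θ) / sin (d - c) * p⁻¹ with hA
    set B := T (pt r θ) / sin (d - c) * q⁻¹ with hB
    have hA0 : 0 < A := by positivity
    have hB0 : 0 < B := by positivity
    have hAB : A + B ≤ 1 := by
      have : A + B = (q * S (pt r θ) + p * T (pt r θ)) / (p * q * sin (d - c)) := by
        rw [hA, hB]; field_simp
      rw [this, div_le_one (by positivity)]; exact h
    have hmid := hconv hpP hqP (a := A / (A + B)) (b := B / (A + B)) (by positivity) (by positivity)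
      (by field_simp)
    have := hconv.smul_mem_of_zero_mem h0 hmid (t := A + B) ⟨by positivity, hAB⟩
    convert this using 1
    rw [smul_add, smul_smul, smul_smul, mul_div_cancel₀ _ (by positivity), mul_div_cancel₀ _ (by positivity)]

noncomputable def phi (P : Set ℂ) (l θ : ℝ) : ℝ :=
  ∫ r in Ioi (0:ℝ), r * P.indicator (fun z => ‖z‖ ^ 2 - 2 * l) (pt r θ)

lemma phi_eq (P : Set ℂ) (l θ N : ℝ) (hN : 0 < N) (h : ∀ r, 0 < r → (pt r θ ∈ P ↔ r * N ≤ 1)) :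
    phi P l θ = 1 / (4 * N ^ 4) - l / N ^ 2 := by
  have hN1 : (0:ℝ) ≤ 1 / N := by positivity
  have e : ∀ r ∈ Ioi (0:ℝ), r * P.indicator (fun z => ‖z‖ ^ 2 - 2 * l) (pt r θ) =
      (Iic (1 / N)).indicator (fun r => r ^ 3 - 2 * l * r) r := by
    intro r hr
    by_cases hm : pt r θ ∈ P
    · have : r ∈ Iic (1 / N) := by
        rw [mem_Iic, le_div_iff₀ hN]; exact (h r hr).1 hm
      rw [indicator_of_mem hm, indicator_of_mem this, norm_pt_sq]; ring
    · have : r ∉ Iic (1 / N) := by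
        rw [mem_Iic, le_div_iff₀ hN]; exact fun hh => hm ((h r hr).2 hh)
      rw [indicator_of_notMem hm, indicator_of_notMem this, mul_zero]
  rw [phi, setIntegral_congr_fun measurableSet_Ioi e, setIntegral_indicator measurableSet_Iic,
    Ioi_inter_Iic, ← intervalIntegral.integral_of_le hN1, intervalIntegral.integral_sub,
    intervalIntegral.integral_const_mul, integral_pow, integral_id]
  · simp only [Nat.reduceAdd, Nat.cast_ofNat]; field_simp; ring
  · exact (by fun_prop : Continuous fun r : ℝ => r ^ 3).intervalIntegrable _ _
  · exact (by fun_prop : Continuous fun r : ℝ => 2 * l * r).intervalIntegrable _ _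

lemma phi_arc (V : Set ℂ) (hVf : V.Finite) (h0 : (0:ℂ) ∈ interior (convexHull ℝ V)) (l c d : ℝ)
    (hcd : c < d) (hno : ∀ v ∈ V, ∀ θ ∈ Ioo c d, ∀ r, 0 < r → v ≠ pt r θ) :
    IntervalIntegrable (phi (convexHull ℝ V) l) volume c d ∧ d - c < π ∧
    - (3 * l ^ 2 * (sin (d - c) / (2 + cos (d - c)))) ≤ ∫ θ in c..d, phi (convexHull ℝ V) l θ := by
  have hd := gap_lt_pi V h0 c d hno
  have hc : IsCompact (convexHull ℝ V) := hVf.isCompact_convexHull ℝ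
  obtain ⟨p, hp, hpP, hpm⟩ := exists_radius _ hc h0 c
  obtain ⟨q, hq, hqP, hqm⟩ := exists_radius _ hc h0 d
  have hsu : 0 < sin (d - c) := sin_pos_of_pos_of_lt_pi (by linarith) hd
  have hphi : ∀ θ ∈ Ioo c d, phi (convexHull ℝ V) l θ =
      1 / (4 * Nf p q c d θ ^ 4) - l / Nf p q c d θ ^ 2 := by
    intro θ hθ
    apply phi_eq
    · exact div_pos (Nf_pos p q c d θ hp hq hcd hd ⟨hθ.1.le, hθ.2.le⟩) (by positivity)
    · exact sector_mem V (interior_subset h0) c d p q hcd hd hp hq hno hpP hpm hqP hqm θ hθ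
  obtain ⟨i1, e1⟩ := arc_integral p q c d l hp hq hcd hd
  have hae : (fun θ => 1 / (4 * Nf p q c d θ ^ 4) - l / Nf p q c d θ ^ 2)
      =ᵐ[volume.restrict (Ioc c d)] phi (convexHull ℝ V) l := by
    rw [← Measure.restrict_congr_set (Ioo_ae_eq_Ioc (a := c) (b := d))]
    filter_upwards [ae_restrict_mem measurableSet_Ioo] with θ hθ
    exact (hphi θ hθ).symm
  refine ⟨?_, hd, ?_⟩
  · rw [intervalIntegrable_iff_integrableOn_Ioc_of_le hcd.le] at i1 ⊢
    exact i1.congr hae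
  · rw [intervalIntegral.integral_of_le hcd.le] at e1 ⊢
    rw [← integral_congr_ae hae, e1]
    exact arc_ineq p q _ l hp hq hsu.le

lemma phi_total (P : Set ℂ) (hc : IsCompact P) (l a : ℝ) :
    ∫ θ in a..(a + 2 * π), phi P l θ = ∫ z in P, (‖z‖ ^ 2 - 2 * l) := by
  have hper : Function.Periodic (phi P l) (2 * π) := by
    intro θ
    have : ∀ r, pt r (θ + 2 * π) = pt r θ := fun r => by simp [pt]
    simp only [phi, this]
  rw [hper.intervalIntegral_add_eq a (-π), show -π + 2 * π = π by ring,
    intervalIntegral.integral_of_le (by linarith [pi_pos]), integral_Ioc_eq_integral_Ioo,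
    ← integral_indicator hc.measurableSet, ← Complex.integral_comp_polarCoord_symm]
  have hsymm : ∀ x : ℝ × ℝ, Complex.polarCoord.symm x = pt x.1 x.2 := by
    intro x
    rw [Complex.polarCoord_symm_apply]
    apply Complex.ext <;> simp [pt, -Complex.ofReal_cos, -Complex.ofReal_sin]
  simp only [hsymm, smul_eq_mul]
  rw [show polarCoord.target = Ioi (0:ℝ) ×ˢ Ioo (-π) π from rfl, Measure.volume_eq_prod]
  rw [← Measure.prod_restrict, integral_prod_symm]
  · rfl
  · rw [Measure.prod_restrict, ← Measure.volume_eq_prod]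
    change IntegrableOn _ _ _
    obtain ⟨R, hR⟩ := hc.isBounded.exists_norm_le
    have hS : MeasurableSet ((fun x : ℝ × ℝ => pt x.1 x.2) ⁻¹' P) :=
      hc.measurableSet.preimage continuous_pt.measurable
    have hcf : Continuous (fun x : ℝ × ℝ => x.1 * (‖pt x.1 x.2‖ ^ 2 - 2 * l)) := by
      have := continuous_pt
      fun_prop
    have e : (fun z : ℝ × ℝ => z.1 * P.indicator (fun z => ‖z‖ ^ 2 - 2 * l) (pt z.1 z.2)) =
        ((fun x : ℝ × ℝ => pt x.1 x.2) ⁻¹' P).indicator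
          (fun x : ℝ × ℝ => x.1 * (‖pt x.1 x.2‖ ^ 2 - 2 * l)) := by
      funext x
      by_cases hm : pt x.1 x.2 ∈ P
      · rw [indicator_of_mem hm, indicator_of_mem (by exact hm)]
      · rw [indicator_of_notMem hm, indicator_of_notMem (by exact hm), mul_zero]
    rw [e]
    have hK : IntegrableOn (((fun x : ℝ × ℝ => pt x.1 x.2) ⁻¹' P).indicator
          (fun x : ℝ × ℝ => x.1 * (‖pt x.1 x.2‖ ^ 2 - 2 * l))) (Icc 0 R ×ˢ Icc (-π) π) volume :=
      Integrable.indicator (hcf.continuousOn.integrableOn_compact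
        (isCompact_Icc.prod isCompact_Icc)) hS
    refine hK.of_forall_sdiff_eq_zero (measurableSet_Ioi.prod measurableSet_Ioo) ?_
    rintro ⟨r, θ⟩ ⟨⟨h1, h2⟩, h3⟩
    apply indicator_of_notMem
    intro hm
    apply h3
    have hr : 0 < r := h1
    have hb := hR _ hm
    have hn : ‖pt r θ‖ = r := by
      have := norm_pt_sq r θ
      exact (pow_left_inj₀ (norm_nonneg _) hr.le two_ne_zero).1 this
    simp only at hb
    rw [hn] at hb
    exact ⟨⟨hr.le, hb⟩, ⟨h2.1.le, h2.2.le⟩⟩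

lemma arg_pt (r θ : ℝ) (hr : 0 < r) : ∃ k : ℤ, (pt r θ).arg = θ - k • (2 * π) := by
  have : pt r θ = r * (Complex.cos θ + Complex.sin θ * Complex.I) := by
    rw [← Complex.ofReal_cos, ← Complex.ofReal_sin]
    apply Complex.ext <;> simp [pt, -Complex.ofReal_cos, -Complex.ofReal_sin]
  rw [this, Complex.arg_mul_cos_add_sin_mul_I_eq_toIocMod hr]
  exact ⟨_, rfl⟩

lemma cFun_eq (n : ℕ) (hn : 3 ≤ n) :
    cFun n = 1 / (3 * n * (sin (2 * π / n) / (2 + cos (2 * π / n)))) := by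
  have hn' : (3:ℝ) ≤ n := by exact_mod_cast hn
  have hx0 : 0 < π / n := by positivity
  have hx1 : π / n < π / 2 := by
    apply div_lt_div_of_pos_left pi_pos (by norm_num) (by linarith)
  have e : 2 * π / n = 2 * (π / n) := by ring
  rw [cFun, e, sin_two_mul, cos_two_mul, tan_eq_sin_div_cos, cot_eq_cos_div_sin]
  have hs : 0 < sin (π / n) := sin_pos_of_pos_of_lt_pi hx0 (by linarith [pi_pos])
  have hc : 0 < cos (π / n) := cos_pos_of_mem_Ioo ⟨by linarith, hx1⟩
  have h1 := sin_sq_add_cos_sq (π / n)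
  generalize sin (π / n) = s at *
  generalize cos (π / n) = k at *
  have hk : 0 < 2 + (2 * k ^ 2 - 1) := by nlinarith
  field_simp
  nlinarith

lemma main_zero (n : ℕ) (hn : 3 ≤ n) (V : Finset ℂ) (hV : V.card = n)
    (h0 : (0:ℂ) ∈ interior (convexHull ℝ (V : Set ℂ))) :
    cFun n * (volume.real (convexHull ℝ (V : Set ℂ))) ^ 2 ≤
      ∫ z in convexHull ℝ (V : Set ℂ), ‖z‖ ^ 2 := by
  have hn' : (3:ℝ) ≤ n := by exact_mod_cast hn
  have hc : IsCompact (convexHull ℝ (V : Set ℂ)) := V.finite_toSet.isCompact_convexHull ℝ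
  set m := volume.real (convexHull ℝ (V : Set ℂ)) with hm
  set u := 2 * π / n with hu
  have hu0 : 0 < u := by positivity
  have hu1 : u < π := by
    rw [hu, div_lt_iff₀ (by linarith)]; nlinarith [pi_pos]
  set H := sin u / (2 + cos u) with hH
  set H' := (2 * cos u + 1) / (2 + cos u) ^ 2 with hH'
  have hHpos : 0 < H := div_pos (sin_pos_of_pos_of_lt_pi hu0 hu1) (by linarith [neg_one_le_cos u])
  rw [cFun_eq n hn, ← hu, ← hH]
  set l := m / (3 * n * H) with hl
  obtain ⟨v0, hv0, hv0'⟩ := Finset.exists_mem_ne (by omega : 1 < V.card) (0:ℂ)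
  set a := v0.arg with ha
  let ang : ℂ → ℝ := fun v => toIcoMod two_pi_pos a v.arg
  have hang0 : ang v0 = a := by
    simp only [ang]
    rw [← ha, toIcoMod_apply_left]
  have hangpt : ∀ r θ, 0 < r → θ ∈ Ico a (a + 2 * π) → ang (pt r θ) = θ := by
    intro r θ hr hθ
    obtain ⟨k, hk⟩ := arg_pt r θ hr
    simp only [ang]
    rw [hk, toIcoMod_sub_zsmul, (toIcoMod_eq_self two_pi_pos).2 hθ]
  let Θ : Finset ℝ := ((V.erase v0).image ang).filter (fun θ => θ ∈ Ioo a (a + 2 * π))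
  have hcard : (Θ.card : ℝ) + 1 ≤ n := by
    have h1 : Θ.card ≤ (V.erase v0).card :=
      (Finset.card_filter_le _ _).trans Finset.card_image_le
    rw [Finset.card_erase_of_mem hv0] at h1
    have : Θ.card + 1 ≤ n := by omega
    exact_mod_cast this
  obtain ⟨-, hsplit⟩ := split_ineq (phi (convexHull ℝ (V : Set ℂ)) l) (-(3 * l ^ 2 * (H - H' * u)))
    (-(3 * l ^ 2 * H')) a Θ (a + 2 * π) (by linarith [pi_pos])
    (fun θ hθ => (Finset.mem_filter.1 hθ).2) (by
      intro c d hcd hac hdb hno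
      obtain ⟨i1, i2, i3⟩ := phi_arc (V : Set ℂ) V.finite_toSet h0 l c d hcd (by
        intro v hv θ hθ r hr hvr
        have hθ' : θ ∈ Ioo a (a + 2 * π) := ⟨hac.trans_lt hθ.1, hθ.2.trans_le hdb⟩
        have hav : ang v = θ := by rw [hvr]; exact hangpt r θ hr ⟨hθ'.1.le, hθ'.2⟩
        by_cases hvv : v = v0
        · rw [hvv, hang0] at hav
          exact absurd hθ'.1 (by rw [hav]; exact lt_irrefl _)
        · exact hno θ (Finset.mem_filter.2 ⟨Finset.mem_image.2
            ⟨v, Finset.mem_erase.2 ⟨hvv, hv⟩, hav⟩, hθ'⟩) hθ)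
      refine ⟨i1, le_trans ?_ i3⟩
      have ht := H_tangent u (d - c) ⟨hu0, hu1⟩ ⟨by linarith, i2.le⟩
      rw [← hH, ← hH'] at ht
      nlinarith [mul_le_mul_of_nonneg_left ht (by positivity : 0 ≤ 3 * l ^ 2)])
  rw [phi_total _ hc] at hsplit
  have ht0 := H_tangent u 0 ⟨hu0, hu1⟩ ⟨le_rfl, pi_pos.le⟩
  rw [← hH, ← hH', sin_zero, zero_div] at ht0
  have hint : IntegrableOn (fun z : ℂ => ‖z‖ ^ 2) (convexHull ℝ (V : Set ℂ)) :=
    (by fun_prop : Continuous fun z : ℂ => ‖z‖ ^ 2).continuousOn.integrableOn_compact hc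
  have hsub : ∫ z in convexHull ℝ (V : Set ℂ), (‖z‖ ^ 2 - 2 * l) =
      (∫ z in convexHull ℝ (V : Set ℂ), ‖z‖ ^ 2) - 2 * l * m := by
    rw [integral_sub hint (integrableOn_const hc.measure_lt_top.ne), setIntegral_const, ← hm,
      smul_eq_mul]
    ring
  rw [hsub] at hsplit
  have hnu : n * u = 2 * π := by rw [hu]; field_simp
  have hk : (Θ.card + 1) * (3 * l ^ 2 * (H - H' * u)) ≤ n * (3 * l ^ 2 * (H - H' * u)) :=
    mul_le_mul_of_nonneg_right hcard (mul_nonneg (by positivity) (by linarith))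
  have hfin : 1 / (3 * n * H) * m ^ 2 = 2 * l * m - n * (3 * l ^ 2 * H) := by
    rw [hl]; field_simp; ring
  rw [hfin]
  have : n * (3 * l ^ 2 * (H - H' * u)) + 3 * l ^ 2 * H' * (2 * π) = n * (3 * l ^ 2 * H) := by
    rw [← hnu]; ring
  nlinarith

lemma main_interior (n : ℕ) (hn : 3 ≤ n) (V : Finset ℂ) (hV : V.card = n) (ξ : ℂ)
    (h0 : ξ ∈ interior (convexHull ℝ (V : Set ℂ))) :
    cFun n * (volume.real (convexHull ℝ (V : Set ℂ))) ^ 2 ≤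
      ∫ z in convexHull ℝ (V : Set ℂ), ‖z - ξ‖ ^ 2 := by
  classical
  have hpre : (convexHull ℝ ((V.image (fun z => -ξ + z) : Finset ℂ) : Set ℂ)) =
      (fun z => -ξ + z) '' (convexHull ℝ (V : Set ℂ)) := by
    have := convexHull_vadd (𝕜 := ℝ) (-ξ) (V : Set ℂ)
    rw [Finset.coe_image]
    exact this
  have hpre2 : (fun z => -ξ + z) ⁻¹' ((fun z => -ξ + z) '' (convexHull ℝ (V : Set ℂ))) =
      (convexHull ℝ (V : Set ℂ)) := preimage_image_eq _ (add_right_injective (-ξ))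
  have hint0 : (0:ℂ) ∈ interior (convexHull ℝ ((V.image (fun z => -ξ + z) : Finset ℂ) : Set ℂ)) := by
    rw [hpre]
    have := (Homeomorph.addLeft (-ξ)).image_interior (convexHull ℝ (V : Set ℂ))
    simp only [Homeomorph.coe_addLeft] at this
    rw [← this]
    exact ⟨ξ, h0, by simp⟩
  have := main_zero n hn (V.image (fun z => -ξ + z))
    (by rw [Finset.card_image_of_injective _ (add_right_injective (-ξ)), hV]) hint0
  rw [hpre] at this
  have hmp : MeasurePreserving (fun z : ℂ => -ξ + z) volume volume :=
    measurePreserving_add_left volume (-ξ)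
  have he : MeasurableEmbedding (fun z : ℂ => -ξ + z) := measurableEmbedding_addLeft (-ξ)
  rw [← hmp.setIntegral_preimage_emb he, hpre2] at this
  rw [Measure.real, ← hmp.measure_preimage_emb he, hpre2] at this
  refine this.trans_eq ?_
  congr 1
  funext z
  rw [neg_add_eq_sub]

lemma main_complex (n : ℕ) (hn : 3 ≤ n) (V : Finset ℂ) (hV : V.card = n) (ξ : ℂ)
    (hpos : volume (convexHull ℝ (V : Set ℂ)) ≠ 0) :
    cFun n * (volume.real (convexHull ℝ (V : Set ℂ))) ^ 2 ≤
      ∫ z in convexHull ℝ (V : Set ℂ), ‖z - ξ‖ ^ 2 := by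
  have hint := main_interior n hn V hV
  have hc : IsCompact (convexHull ℝ (V : Set ℂ)) := V.finite_toSet.isCompact_convexHull ℝ
  have hconv : Convex ℝ (convexHull ℝ (V : Set ℂ)) := convex_convexHull ℝ _
  generalize convexHull ℝ (V : Set ℂ) = P at *
  set K := cFun n * volume.real P ^ 2
  have hI : ∀ η : ℂ, IntegrableOn (fun z : ℂ => ‖z - η‖ ^ 2) P := fun η =>
    (by fun_prop : Continuous fun z : ℂ => ‖z - η‖ ^ 2).continuousOn.integrableOn_compact hc
  have hne : (interior P).Nonempty := by
    rw [nonempty_iff_ne_empty]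
    intro he
    apply hpos
    apply measure_mono_null _ (hconv.addHaar_frontier volume)
    rw [frontier, he, sdiff_empty]; exact subset_closure
  obtain ⟨x0, hx0⟩ := hne
  obtain ⟨x1, hx1, hmin⟩ := exists_norm_eq_iInf_of_complete_convex
    ⟨x0, interior_subset hx0⟩ hc.isComplete hconv ξ
  rw [norm_eq_iInf_iff_real_inner_le_zero hconv hx1] at hmin
  have h1 : ∫ z in P, ‖z - x1‖ ^ 2 ≤ ∫ z in P, ‖z - ξ‖ ^ 2 := by
    apply setIntegral_mono_on (hI _) (hI _) hc.measurableSet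
    intro z hz
    have e : z - ξ = (z - x1) - (ξ - x1) := by ring
    have := hmin z hz
    rw [real_inner_comm] at this
    rw [e, norm_sub_sq_real (z - x1) (ξ - x1)]
    nlinarith [sq_nonneg ‖ξ - x1‖]
  refine le_trans ?_ h1
  have h2 : ∀ ε ∈ Ioo (0:ℝ) 1, K ≤ ε * (∫ z in P, ‖z - x0‖ ^ 2) + (1 - ε) * ∫ z in P, ‖z - x1‖ ^ 2 := by
    intro ε hε
    have hmem := hconv.combo_interior_closure_mem_interior hx0 (subset_closure hx1) hε.1
      (by linarith [hε.2] : 0 ≤ 1 - ε) (by ring)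
    refine (hint _ hmem).trans ?_
    rw [← integral_const_mul, ← integral_const_mul,
      ← integral_add ((hI x0).const_mul _) ((hI x1).const_mul _)]
    apply setIntegral_mono_on (hI _) (((hI x0).const_mul _).add ((hI x1).const_mul _)) hc.measurableSet
    intro z hz
    have e : z - (ε • x0 + (1 - ε) • x1) = ε • (z - x0) + (1 - ε) • (z - x1) := by
      simp only [Complex.real_smul]; push_cast; ring
    have hle : ‖z - (ε • x0 + (1 - ε) • x1)‖ ≤ ε * ‖z - x0‖ + (1 - ε) * ‖z - x1‖ := by
      rw [e]
      refine (norm_add_le _ _).trans ?_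
      rw [norm_smul, norm_smul, Real.norm_of_nonneg hε.1.le,
        Real.norm_of_nonneg (by linarith [hε.2] : 0 ≤ 1 - ε)]
    refine (pow_le_pow_left₀ (norm_nonneg _) hle 2).trans ?_
    have : 0 ≤ ε * (1 - ε) * (‖z - x0‖ - ‖z - x1‖) ^ 2 :=
      mul_nonneg (mul_nonneg hε.1.le (by linarith [hε.2])) (sq_nonneg _)
    simp only [Pi.add_apply]
    nlinarith
  have hcont : Filter.Tendsto (fun ε : ℝ => ε * (∫ z in P, ‖z - x0‖ ^ 2) + (1 - ε) * ∫ z in P, ‖z - x1‖ ^ 2)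
      (nhdsWithin 0 (Ioi 0)) (nhds (0 * (∫ z in P, ‖z - x0‖ ^ 2) + (1 - 0) * ∫ z in P, ‖z - x1‖ ^ 2)) := by
    apply tendsto_nhdsWithin_of_tendsto_nhds
    exact (by fun_prop : Continuous (fun ε : ℝ => ε * (∫ z in P, ‖z - x0‖ ^ 2) + (1 - ε) * ∫ z in P, ‖z - x1‖ ^ 2)).tendsto 0
  rw [zero_mul, sub_zero, one_mul, zero_add] at hcont
  apply ge_of_tendsto hcont
  filter_upwards [Ioo_mem_nhdsGT (zero_lt_one' ℝ)] with ε hε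
  exact h2 ε hε

/-- For any convex `n`-gon `P` of area `m > 0` and any point `ξ ∈ ℝ²`,
`∫_P |x − ξ|² dx ≥ c_n · m²`. -/
theorem stmt2 (n : ℕ) (hn : 3 ≤ n) (P : Set (EuclideanSpace ℝ (Fin 2)))
    (ξ : EuclideanSpace ℝ (Fin 2)) (m : ℝ) (hm : 0 < m)
    (hP : IsConvexNGon n P) (harea : volume P = ENNReal.ofReal m) :
    cFun n * m ^ 2 ≤ ∫ x in P, ‖x - ξ‖ ^ 2 := by
  classical
  obtain ⟨V, hV, rfl⟩ := hP
  let e : ℂ ≃ₗᵢ[ℝ] EuclideanSpace ℝ (Fin 2) := Complex.orthonormalBasisOneI.repr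
  have hmp : MeasurePreserving e volume volume := e.measurePreserving
  have he : MeasurableEmbedding e := e.toHomeomorph.measurableEmbedding
  have hW : convexHull ℝ ((V.image e.symm : Finset ℂ) : Set ℂ) =
      e ⁻¹' (convexHull ℝ (V : Set (EuclideanSpace ℝ (Fin 2)))) := by
    rw [Finset.coe_image]
    have h1 := e.symm.toLinearEquiv.toLinearMap.image_convexHull
      (V : Set (EuclideanSpace ℝ (Fin 2)))
    have h2 : e.symm '' (convexHull ℝ (V : Set (EuclideanSpace ℝ (Fin 2)))) =
      e ⁻¹' (convexHull ℝ (V : Set (EuclideanSpace ℝ (Fin 2)))) := e.symm.toEquiv.image_eq_preimage_symm _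
    rw [← h2]
    exact h1.symm
  have hvol : volume (convexHull ℝ ((V.image e.symm : Finset ℂ) : Set ℂ)) = ENNReal.ofReal m := by
    rw [hW, hmp.measure_preimage_emb he, harea]
  have := main_complex n hn (V.image e.symm)
    (by rw [Finset.card_image_of_injective _ e.symm.injective, hV]) (e.symm ξ)
    (by rw [hvol]; simpa using hm)
  rw [Measure.real, hvol, ENNReal.toReal_ofReal hm.le, hW] at this
  refine this.trans_eq ?_
  rw [← hmp.setIntegral_preimage_emb he]
  congr 1
  funext z
  rw [← e.norm_map (z - e.symm ξ), map_sub, e.apply_symm_apply]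
end
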